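/- arXiv:1512.06946 — 2 statements merged into one kernel-verified Lean document; each statement's English description precedes it below -/
import Mathlib

section
/- (Ore's conditions, necessity) Let K be a finite extension of Q_p with normalized valuation v_P, and let f ∈ O_K[x] be an Eisenstein polynomial of degree n with discriminant of valuation n + J_0 − 1, where J_0 = a_0·n + b_0 with 0 ≤ b_0 < n. Then min( n·v_P(b_0), n·v_P(n) ) ≤ J_0 ≤ n·v_P(n), where v_P(0) is interpreted as +∞ (so if b_0 = 0 the lower bound is n·v_P(n) and J_0 = n·v_P(n)). -/
open Polynomial

/-- An additive valuation `v` (written additively, with `v 0 = ⊤`) on a field `Ω`,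
extending the `p`-adic valuation of `ℚ_[p]` (scaled by the ramification index `e`),
taking integer values on an intermediate field `K` and normalized so that a
uniformizer `unif` of `K` has valuation `1`. -/
structure PadicSetup (p : ℕ) [Fact p.Prime] (K Ω : Type*) [Field K] [Field Ω]
    [Algebra ℚ_[p] K] [Algebra ℚ_[p] Ω] [Algebra K Ω] [IsScalarTower ℚ_[p] K Ω] where
  v : Ω → WithTop ℚ
  v_top_iff : ∀ x : Ω, v x = ⊤ ↔ x = 0
  v_mul : ∀ x y : Ω, v (x * y) = v x + v y
  v_add : ∀ x y : Ω, min (v x) (v y) ≤ v (x + y)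
  e : ℕ
  e_pos : 0 < e
  v_padic : ∀ x : ℚ_[p], x ≠ 0 →
    v (algebraMap ℚ_[p] Ω x) = (((e : ℤ) * x.valuation : ℤ) : ℚ)
  v_int : ∀ x : K, x ≠ 0 → ∃ m : ℤ, v (algebraMap K Ω x) = ((m : ℚ) : WithTop ℚ)
  unif : K
  v_unif : v (algebraMap K Ω unif) = 1

variable {p : ℕ} [Fact p.Prime] {K Ω : Type*} [Field K] [Field Ω]
    [Algebra ℚ_[p] K] [Algebra ℚ_[p] Ω] [Algebra K Ω] [IsScalarTower ℚ_[p] K Ω]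

/-- `f` is an Eisenstein polynomial of degree `n` over `K` (with respect to the
normalized valuation of `K`): monic of degree `n`, all lower coefficients have
valuation at least `1`, and the constant coefficient has valuation exactly `1`. -/
def PadicSetup.IsEisensteinOfDegree (S : PadicSetup p K Ω) (f : K[X]) (n : ℕ) : Prop :=
  f.Monic ∧ f.natDegree = n ∧ (∀ i < n, 1 ≤ S.v (algebraMap K Ω (f.coeff i))) ∧
    S.v (algebraMap K Ω (f.coeff 0)) = 1

/-- The `i`-th coefficient of the ramification polynomial `ρ(x) = f(αx+α)/αⁿ` of `f`,
namely `ρ_i = ∑_{k=i}^n C(k,i) f_k α^{k-n}`. -/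
noncomputable def PadicSetup.rho (S : PadicSetup p K Ω) (f : K[X]) (n : ℕ) (α : Ω)
    (i : ℕ) : Ω :=
  ∑ k ∈ Finset.Icc i n, (k.choose i : Ω) * algebraMap K Ω (f.coeff k) * α ^ ((k : ℤ) - (n : ℤ))

theorem AddValuation.map_sum_eq_of_forall_lt {R Γ₀ ι : Type*} [Ring R]
    [LinearOrderedAddCommMonoidWithTop Γ₀] (v : AddValuation R Γ₀) {s : Finset ι} {g : ι → R}
    {j : ι} (hj : j ∈ s) (hlt : ∀ i ∈ s, i ≠ j → v (g j) < v (g i)) :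
    v (∑ i ∈ s, g i) = v (g j) := by
  classical
  exact Valuation.map_sum_eq_of_lt (AddValuation.toValuation v) hj fun i hi => by
    simp only [Finset.mem_sdiff, Finset.mem_singleton] at hi
    exact hlt i hi.1 hi.2

namespace PadicSetup

theorem v_one (S : PadicSetup p K Ω) : S.v 1 = 0 := by
  have hne : S.v 1 ≠ ⊤ := fun h => one_ne_zero ((S.v_top_iff 1).1 h)
  have h := S.v_mul 1 1
  rw [mul_one] at h
  lift S.v 1 to ℚ using hne with a
  norm_cast at h ⊢
  linarith

/-- The valuation of a `PadicSetup` as a Mathlib `AddValuation`. -/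
noncomputable def addValuation (S : PadicSetup p K Ω) : AddValuation Ω (WithTop ℚ) :=
  AddValuation.of S.v ((S.v_top_iff 0).2 rfl) S.v_one S.v_add S.v_mul

theorem addValuation_apply (S : PadicSetup p K Ω) (x : Ω) : S.addValuation x = S.v x := rfl

theorem v_mul_pow (S : PadicSetup p K Ω) {c α : Ω} {m a : ℚ} (hc : S.v c = m) (ha : S.v α = a)
    (i : ℕ) : S.v (c * α ^ i) = ((m + i * a : ℚ) : WithTop ℚ) := by
  have hpow : S.v (α ^ i) = i • S.v α := S.addValuation.map_pow α i
  rw [S.v_mul, hpow, hc, ha, WithTop.coe_add, ← nsmul_eq_mul, WithTop.coe_nsmul]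

theorem le_v_mul_pow (S : PadicSetup p K Ω) {c α : Ω} {m a : ℚ} (hc : (m : WithTop ℚ) ≤ S.v c)
    (ha : S.v α = a) (i : ℕ) : ((m + i * a : ℚ) : WithTop ℚ) ≤ S.v (c * α ^ i) := by
  have hpow : S.v (α ^ i) = i • S.v α := S.addValuation.map_pow α i
  rw [S.v_mul, hpow, ha, WithTop.coe_add, ← nsmul_eq_mul, WithTop.coe_nsmul]
  gcongr

/-- A root of an Eisenstein polynomial of degree `n` has valuation `1 / n`. -/
theorem IsEisensteinOfDegree.v_root {S : PadicSetup p K Ω} {f : K[X]} {n : ℕ} (hn : 0 < n)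
    (hf : S.IsEisensteinOfDegree f n) {α : Ω} (hα : aeval α f = 0) :
    ∃ a : ℚ, S.v α = a ∧ n * a = 1 := by
  obtain ⟨hmonic, hdeg, hcoeff, hzero⟩ := hf
  have hα0 : α ≠ 0 := by
    rintro rfl
    rw [← coeff_zero_eq_aeval_zero'] at hα
    rw [hα, (S.v_top_iff 0).2 rfl] at hzero
    exact WithTop.top_ne_one hzero
  obtain ⟨a, ha⟩ := WithTop.ne_top_iff_exists.1 (mt (S.v_top_iff α).1 hα0)
  replace ha := ha.symm
  have hpow : S.v (α ^ n) = ((n * a : ℚ) : WithTop ℚ) := by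
    simpa using S.v_mul_pow (m := 0) S.v_one ha n
  have hsum : S.v (∑ i ∈ Finset.range n, algebraMap K Ω (f.coeff i) * α ^ i)
      = ((n * a : ℚ) : WithTop ℚ) := by
    rw [aeval_eq_sum_range, hdeg, Finset.sum_range_succ, ← hdeg, hmonic.coeff_natDegree, hdeg,
      one_smul] at hα
    simp only [Algebra.smul_def] at hα
    rw [eq_neg_of_add_eq_zero_left hα]
    exact (S.addValuation.map_neg _).trans hpow
  have hle (i : ℕ) (hi : i < n) := S.le_v_mul_pow (m := 1) (hcoeff i hi) ha i
  have hapos : 0 < a := by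
    by_contra! hneg
    refine (S.addValuation.map_lt_sum (g := ((n * a : ℚ) : WithTop ℚ)) (WithTop.coe_ne_top)
      (s := Finset.range n) (f := fun i => algebraMap K Ω (f.coeff i) * α ^ i)
      fun i hi => ?_).ne' hsum
    have hi := Finset.mem_range.1 hi
    refine lt_of_lt_of_le (WithTop.coe_lt_coe.2 ?_) (hle i hi)
    have : (i : ℚ) ≤ n := by exact_mod_cast hi.le
    nlinarith
  refine ⟨a, ha, ?_⟩
  have hconst : S.v (algebraMap K Ω (f.coeff 0) * α ^ 0) = 1 := by simpa using hzero
  have := S.addValuation.map_sum_eq_of_forall_lt (s := Finset.range n)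
    (g := fun i => algebraMap K Ω (f.coeff i) * α ^ i) (Finset.mem_range.2 hn) fun i hi hi0 => by
      refine (hconst.trans_lt ?_).trans_le (hle i (Finset.mem_range.1 hi))
      have : (0 : ℚ) < i := by exact_mod_cast Nat.pos_of_ne_zero hi0
      exact_mod_cast (by nlinarith [mul_pos this hapos] : (1 : ℚ) < 1 + i * a)
  exact_mod_cast hsum.symm.trans (this.trans hconst)

/-- If `v α = 1 / n`, the monomials `c_i α ^ i` with `i < n` have pairwise distinct valuations,
so the valuation of a polynomial of degree less than `n` at `α` is attained at one of them. -/
theorem exists_v_aeval_eq (S : PadicSetup p K Ω) {n : ℕ} {α : Ω} {a : ℚ} (ha : S.v α = a)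
    (hna : n * a = 1) {g : K[X]} (hg : g.natDegree < n) (hg0 : aeval α g ≠ 0) :
    ∃ k < n, S.v (aeval α g) = S.v (algebraMap K Ω (g.coeff k) * α ^ k) ∧
      ∀ j < n, S.v (aeval α g) ≤ S.v (algebraMap K Ω (g.coeff j) * α ^ j) := by
  set t : ℕ → Ω := fun i => algebraMap K Ω (g.coeff i) * α ^ i with ht
  have hsum : aeval α g = ∑ i ∈ Finset.range n, t i := by
    rw [aeval_eq_sum_range' hg]
    simp only [ht, Algebra.smul_def]
  obtain ⟨k, hk, hmin⟩ := Finset.exists_min_image (Finset.range n) (fun i => S.v (t i))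
    ⟨0, Finset.mem_range.2 (by omega)⟩
  have hn0 : (n : ℚ) ≠ 0 := left_ne_zero_of_mul_eq_one hna
  have key (i : ℕ) (hi : t i ≠ 0) : ∃ m : ℤ, S.v (t i) = ((m + i * a : ℚ) : WithTop ℚ) := by
    obtain ⟨m, hm⟩ := S.v_int (g.coeff i) fun h => hi (by simp [ht, h])
    exact ⟨m, S.v_mul_pow hm ha i⟩
  have htk : t k ≠ 0 := fun h => hg0 <| by
    rw [hsum]
    refine Finset.sum_eq_zero fun i hi => (S.v_top_iff _).1 (top_le_iff.1 ?_)
    simpa [h, (S.v_top_iff 0).2 rfl] using hmin i hi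
  have hval : S.v (aeval α g) = S.v (t k) := by
    rw [hsum]
    refine S.addValuation.map_sum_eq_of_forall_lt hk fun i hi hik =>
      lt_of_le_of_ne (hmin i hi) fun heq => hik ?_
    simp only [addValuation_apply] at heq
    have hti : t i ≠ 0 := fun h => htk ((S.v_top_iff _).1 (heq.trans ((S.v_top_iff _).2 h)))
    obtain ⟨m, hm⟩ := key k htk
    obtain ⟨l, hl⟩ := key i hti
    rw [hm, hl, WithTop.coe_inj] at heq
    have hmod : (n * m + k : ℤ) = n * l + i := by
      have : (n * m + k : ℚ) = n * l + i := by linear_combination n * heq + (i - k) * hna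
      exact_mod_cast this
    have hkn := Finset.mem_range.1 hk
    have hin := Finset.mem_range.1 hi
    have := congrArg (· % (n : ℤ)) hmod
    simp only [Int.mul_add_emod_self_left] at this
    norm_cast at this
    rwa [Nat.mod_eq_of_lt hkn, Nat.mod_eq_of_lt hin, eq_comm] at this
  exact ⟨k, Finset.mem_range.1 hk, hval, fun j hj => hval ▸ hmin j (Finset.mem_range.2 hj)⟩

end PadicSetup

/-- **Ore's conditions, necessity.** Let `f` be an Eisenstein polynomial of
degree `n` over `K` whose discriminant has valuation `n + J₀ - 1`, expressed (as in the
paper) through a root `α` by `v_α(f'(α)) = n + J₀ - 1` where `v_α = n·v`.  Writing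
`J₀ = a₀ n + b₀` with `0 ≤ b₀ < n`, one has
`min( n·v_P(b₀), n·v_P(n) ) ≤ J₀ ≤ n·v_P(n)` (with `v_P(0) = ⊤`). -/
theorem ore_conditions_necessity
    [FiniteDimensional ℚ_[p] K] [IsAlgClosed Ω] [Algebra.IsAlgebraic K Ω]
    (S : PadicSetup p K Ω)
    (f : K[X]) (n : ℕ) (hn : 0 < n) (hf : S.IsEisensteinOfDegree f n)
    (α : Ω) (hα : aeval α f = 0)
    (J₀ : ℕ)
    (hdisc : ((n : ℚ) : WithTop ℚ) * S.v (aeval α (derivative f)) =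
      ((((n : ℤ) + (J₀ : ℤ) - 1 : ℤ) : ℚ) : WithTop ℚ)) :
    min (((n : ℚ) : WithTop ℚ) * S.v (algebraMap K Ω ((J₀ % n : ℕ) : K)))
        (((n : ℚ) : WithTop ℚ) * S.v (algebraMap K Ω (n : K)))
      ≤ ((J₀ : ℚ) : WithTop ℚ)
    ∧ ((J₀ : ℚ) : WithTop ℚ) ≤ ((n : ℚ) : WithTop ℚ) * S.v (algebraMap K Ω (n : K)) := by
  obtain ⟨a, ha, hna⟩ := hf.v_root hn hα
  obtain ⟨hmonic, hdeg, hcoeff, -⟩ := hf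
  have : CharZero K := charZero_of_injective_algebraMap (algebraMap ℚ_[p] K).injective
  have hn0 : (n : ℚ) ≠ 0 := by exact_mod_cast hn.ne'
  have hder0 : aeval α (derivative f) ≠ 0 := fun h => by
    rw [h, (S.v_top_iff 0).2 rfl, WithTop.mul_top (by exact_mod_cast hn0)] at hdisc
    exact WithTop.top_ne_coe hdisc
  obtain ⟨d, hd⟩ := WithTop.ne_top_iff_exists.1 (mt (S.v_top_iff _).1 hder0)
  have hdJ : (n : ℚ) * d = n + J₀ - 1 := by
    rw [← hd] at hdisc
    exact_mod_cast hdisc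
  obtain ⟨k, hk, hval, hmin⟩ := S.exists_v_aeval_eq ha hna
    (hdeg ▸ natDegree_derivative_lt (hdeg ▸ hn.ne')) hder0
  obtain ⟨N, hN⟩ := S.v_int (n : K) (by exact_mod_cast hn.ne')
  have hlead : S.v (algebraMap K Ω ((derivative f).coeff (n - 1)) * α ^ (n - 1))
      = ((N + (n - 1 : ℕ) * a : ℚ) : WithTop ℚ) := by
    refine S.v_mul_pow ?_ ha _
    rw [coeff_derivative, Nat.sub_add_cancel hn, ← hdeg, hmonic.coeff_natDegree, hdeg, ← hN,
      one_mul]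
    congr 2
    exact_mod_cast Nat.sub_add_cancel hn
  have hcast : ((n - 1 : ℕ) : ℚ) = n - 1 := by rw [Nat.cast_sub hn, Nat.cast_one]
  rw [hN, ← WithTop.coe_mul]
  constructor
  · rcases eq_or_ne k (n - 1) with rfl | hkn
    · refine (min_le_right _ _).trans (WithTop.coe_le_coe.2 (le_of_eq ?_))
      rw [hlead, ← hd, WithTop.coe_inj, hcast] at hval
      linear_combination hdJ - n * hval - (n - 1) * hna
    · refine (min_le_left _ _).trans ?_
      have hkn : k + 1 < n := by omega
      have hcoeff0 : f.coeff (k + 1) ≠ 0 := fun h => by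
        rw [coeff_derivative, h, zero_mul, _root_.map_zero, zero_mul,
          (S.v_top_iff 0).2 rfl, ← hd] at hval
        exact WithTop.coe_ne_top hval
      obtain ⟨m, hm⟩ := S.v_int _ hcoeff0
      obtain ⟨l, hl⟩ := S.v_int ((k + 1 : ℕ) : K) (by exact_mod_cast k.succ_ne_zero)
      have hm1 : (1 : ℚ) ≤ m := by exact_mod_cast hm ▸ hcoeff (k + 1) hkn
      have hprod : S.v (algebraMap K Ω ((derivative f).coeff k)) = ((m + l : ℚ) : WithTop ℚ) := by
        rw [coeff_derivative, _root_.map_mul, S.v_mul, hm, ← Nat.cast_succ, hl, WithTop.coe_add]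
      rw [S.v_mul_pow hprod ha, ← hd, WithTop.coe_inj] at hval
      have hJ : (J₀ : ℚ) = n * (m + l - 1) + (k + 1) := by
        linear_combination n * hval + k * hna - hdJ
      have hJint : (J₀ : ℤ) = (k + 1 : ℕ) + n * (m + l - 1) := by
        have : (J₀ : ℚ) = (k + 1 : ℕ) + n * (m + l - 1) := by push_cast; linarith
        exact_mod_cast this
      have hmod : J₀ % n = k + 1 := by
        have := congrArg (· % (n : ℤ)) hJint
        simp only [Int.add_mul_emod_self_left] at this
        norm_cast at this
        rwa [Nat.mod_eq_of_lt hkn] at this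
      rw [hmod, hl, ← WithTop.coe_mul, WithTop.coe_le_coe, hJ]
      have hnpos : (0 : ℚ) < n := by exact_mod_cast hn
      nlinarith [mul_nonneg hnpos.le (sub_nonneg.2 hm1)]
  · have h := hmin (n - 1) (by omega)
    rw [hlead, ← hd, WithTop.coe_le_coe, hcast] at h
    rw [WithTop.coe_le_coe]
    have hnpos : (0 : ℚ) < n := by exact_mod_cast hn
    nlinarith [mul_le_mul_of_nonneg_left h hnpos.le]
end

section
/- (Krasner's mass formula) Let K be a finite extension of Q_p with residue field of cardinality q, and let n and J_0 = a_0·n + b_0 (0 ≤ b_0 < n) satisfy Ore's conditions. Define l(i) as: max(2 + a_0 − v_P(i), 1) for 1 ≤ i < b_0 and max(1 + a_0 − v_P(i), 1) for b_0 ≤ i ≤ n−1. Then the number of distinct totally ramified extensions L/K of degree n inside a fixed algebraic closure with disc(L/K) = P^{n+J_0−1} equals n · q^{n+J_0−1−Σ_{i=1}^{n−1} l(i)} if b_0 = 0, and n·(q−1)·q^{n+J_0−1−Σ_{i=1}^{n−1} l(i) − 1} if b_0 > 0. -/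
open Polynomial

variable {p : ℕ} [Fact p.Prime] {K Ω : Type*} [Field K] [Field Ω]
    [Algebra ℚ_[p] K] [Algebra ℚ_[p] Ω] [Algebra K Ω] [IsScalarTower ℚ_[p] K Ω]

/-- An integer plus a proper fraction with denominator `n` determines both. -/
theorem eq_of_int_add_div_eq {n i j : ℕ} {k m : ℤ} (hi : i < n) (hj : j < n)
    (h : (k + i / n : ℚ) = m + j / n) : k = m ∧ i = j := by
  have hn : (0 : ℚ) < n := by exact_mod_cast lt_of_le_of_lt (Nat.zero_le _) hi
  field_simp at h
  have h' : (n : ℤ) * k + i = n * m + j := by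
    have : ((n : ℚ) * k + i) = n * m + j := by linarith
    exact_mod_cast this
  have h1 : ((k - m) * n : ℤ) = j - i := by linarith
  have h2 : (k - m : ℤ) = 0 := by
    by_contra hne
    rcases lt_or_gt_of_ne hne with h | h
    · have : (k - m) * (n : ℤ) ≤ (-1) * n := by gcongr; omega
      omega
    · have : 1 * (n : ℤ) ≤ (k - m) * n := by gcongr; omega
      omega
  rw [h2] at h1
  omega

namespace PadicSetup

/-- The function `S.v`, bundled as an additive valuation. -/
noncomputable def addVal (S : PadicSetup p K Ω) : AddValuation Ω (WithTop ℚ) :=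
  AddValuation.of S.v ((S.v_top_iff 0).2 rfl)
    (by
      have h := S.v_mul 1 1
      have h1 : S.v 1 ≠ ⊤ := fun h => one_ne_zero ((S.v_top_iff 1).1 h)
      obtain ⟨r, hr⟩ := WithTop.ne_top_iff_exists.1 h1
      rw [mul_one, ← hr] at h
      rw [← hr]
      norm_cast at h ⊢
      linarith)
    S.v_add S.v_mul

variable (S : PadicSetup p K Ω)

theorem addVal_apply (x : Ω) : S.addVal x = S.v x := rfl

theorem v_zero : S.v 0 = ⊤ := (S.v_top_iff 0).2 rfl

theorem v_one_s7 : S.v 1 = 0 := S.addVal.map_one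

theorem v_neg (x : Ω) : S.v (-x) = S.v x := S.addVal.map_neg x

theorem v_sub_comm (x y : Ω) : S.v (x - y) = S.v (y - x) := S.addVal.map_sub_swap x y

theorem exists_rat {x : Ω} (hx : x ≠ 0) : ∃ r : ℚ, S.v x = (r : WithTop ℚ) := by
  have h1 : S.v x ≠ ⊤ := fun h => hx ((S.v_top_iff x).1 h)
  obtain ⟨r, hr⟩ := WithTop.ne_top_iff_exists.1 h1
  exact ⟨r, hr.symm⟩

theorem ne_zero_of_v {x : Ω} {r : ℚ} (h : S.v x = (r : WithTop ℚ)) : x ≠ 0 := by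
  intro h0
  rw [(S.v_top_iff x).2 h0] at h
  exact WithTop.top_ne_coe h

theorem v_pow {x : Ω} {r : ℚ} (h : S.v x = (r : WithTop ℚ)) (k : ℕ) :
    S.v (x ^ k) = ((k * r : ℚ) : WithTop ℚ) := by
  have := S.addVal.map_pow x k
  rw [addVal_apply, addVal_apply, h] at this
  rw [this, ← nsmul_eq_mul]
  exact (WithTop.coe_nsmul r k).symm

theorem v_inv {x : Ω} {r : ℚ} (h : S.v x = (r : WithTop ℚ)) :
    S.v x⁻¹ = ((-r : ℚ) : WithTop ℚ) := by
  have := S.addVal.map_inv (x := x)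
  rw [addVal_apply, addVal_apply, h] at this
  rw [this]
  rfl

theorem v_zpow {x : Ω} {r : ℚ} (h : S.v x = (r : WithTop ℚ)) (k : ℤ) :
    S.v (x ^ k) = ((k * r : ℚ) : WithTop ℚ) := by
  obtain ⟨m, rfl | rfl⟩ := k.eq_nat_or_neg
  · rw [zpow_natCast, S.v_pow h]
    simp
  · rw [zpow_neg, zpow_natCast, S.v_inv (S.v_pow h m)]
    simp

theorem le_v_add {x y : Ω} {g : WithTop ℚ} (hx : g ≤ S.v x) (hy : g ≤ S.v y) :
    g ≤ S.v (x + y) := S.addVal.map_le_add hx hy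

theorem le_v_sub {x y : Ω} {g : WithTop ℚ} (hx : g ≤ S.v x) (hy : g ≤ S.v y) :
    g ≤ S.v (x - y) := S.addVal.map_le_sub hx hy

theorem le_v_sum {ι : Type*} {s : Finset ι} {f : ι → Ω} {g : WithTop ℚ}
    (hf : ∀ i ∈ s, g ≤ S.v (f i)) : g ≤ S.v (∑ i ∈ s, f i) := S.addVal.map_le_sum hf

theorem v_add_eq_of_lt {x y : Ω} (h : S.v x < S.v y) : S.v (x + y) = S.v x :=
  S.addVal.map_add_eq_of_lt_left h

/-- A sum with a unique term of minimal valuation has the valuation of that term. -/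
theorem v_sum_eq_of_lt {ι : Type*} [DecidableEq ι] {s : Finset ι} {f : ι → Ω} {j : ι} {r : ℚ}
    (hj : j ∈ s) (hr : S.v (f j) = (r : WithTop ℚ))
    (h : ∀ i ∈ s, i ≠ j → (r : WithTop ℚ) < S.v (f i)) :
    S.v (∑ i ∈ s, f i) = (r : WithTop ℚ) := by
  rw [← Finset.add_sum_erase s f hj, ← hr]
  apply S.v_add_eq_of_lt
  rw [hr]
  refine S.addVal.map_lt_sum (WithTop.coe_ne_top) fun i hi => ?_
  rw [Finset.mem_erase] at hi
  exact h i hi.2 hi.1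

theorem v_finset_prod_le {ι : Type*} (s : Finset ι) (f g : ι → Ω)
    (h : ∀ i ∈ s, S.v (f i) ≤ S.v (g i)) : S.v (∏ i ∈ s, f i) ≤ S.v (∏ i ∈ s, g i) := by
  classical
  induction s using Finset.induction_on with
  | empty => simp
  | insert a s ha ih =>
    rw [Finset.prod_insert ha, Finset.prod_insert ha, S.v_mul, S.v_mul]
    exact add_le_add (h a (Finset.mem_insert_self a s))
      (ih fun i hi => h i (Finset.mem_insert_of_mem hi))

theorem v_finset_prod_nonneg {ι : Type*} (s : Finset ι) (g : ι → Ω)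
    (h : ∀ i ∈ s, 0 ≤ S.v (g i)) : 0 ≤ S.v (∏ i ∈ s, g i) := by
  have := S.v_finset_prod_le s (fun _ => 1) g (by simpa [S.v_one_s7] using h)
  simpa [S.v_one_s7] using this

/-- Valuations of elements of `K` are integers, so a strict rational bound can be rounded up. -/
theorem le_v_algebraMap_of_lt {x : K} {r : ℚ} {k : ℤ} (h : (r : WithTop ℚ) ≤ S.v (algebraMap K Ω x))
    (hk : (k : ℚ) - 1 < r) : ((k : ℚ) : WithTop ℚ) ≤ S.v (algebraMap K Ω x) := by
  rcases eq_or_ne x 0 with rfl | hx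
  · simp [S.v_zero]
  · obtain ⟨m, hm⟩ := S.v_int x hx
    rw [hm] at h ⊢
    norm_cast at h ⊢
    have : (k : ℚ) - 1 < m := lt_of_lt_of_le hk h
    have h2 : k - 1 < m := by exact_mod_cast this
    omega

/-- The valuation of a polynomial expression of degree `< n` in an element of valuation `1 / n`
is attained by exactly one of its monomials. -/
theorem v_aeval_eq_min {n : ℕ} {α : Ω} (hα : S.v α = ((1 / n : ℚ) : WithTop ℚ)) {h : K[X]}
    (h0 : h ≠ 0) (hd : h.natDegree < n) :
    ∃ i, i < n ∧ ∃ k : ℤ, S.v (algebraMap K Ω (h.coeff i)) = ((k : ℚ) : WithTop ℚ) ∧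
      S.v (aeval α h) = ((k + i / n : ℚ) : WithTop ℚ) ∧
      ∀ j, ((k + i / n : ℚ) : WithTop ℚ) ≤
        S.v (algebraMap K Ω (h.coeff j)) + ((j / n : ℚ) : WithTop ℚ) := by
  classical
  have hn : (0 : ℚ) < n := by exact_mod_cast lt_of_le_of_lt (Nat.zero_le _) hd
  have hne : h.support.Nonempty := by simpa using h0
  have hval : ∀ i ∈ h.support, ∃ k : ℤ, S.v (algebraMap K Ω (h.coeff i)) = ((k : ℚ) : WithTop ℚ) :=
    fun i hi => S.v_int _ (mem_support_iff.1 hi)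
  have hterm : ∀ i, S.v (algebraMap K Ω (h.coeff i) * α ^ i) =
      S.v (algebraMap K Ω (h.coeff i)) + ((i / n : ℚ) : WithTop ℚ) := fun i => by
    rw [S.v_mul, S.v_pow hα, mul_one_div]
  obtain ⟨i, hi, hmin⟩ := h.support.exists_min_image
    (fun i => S.v (algebraMap K Ω (h.coeff i) * α ^ i)) hne
  obtain ⟨k, hk⟩ := hval i hi
  have hin : i < n := lt_of_le_of_lt (le_natDegree_of_mem_supp i hi) hd
  have hik : S.v (algebraMap K Ω (h.coeff i) * α ^ i) = ((k + i / n : ℚ) : WithTop ℚ) := by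
    rw [hterm, hk]
    rfl
  refine ⟨i, hin, k, hk, ?_, fun j => ?_⟩
  · rw [aeval_eq_sum_range, ← Finset.sum_subset (s₁ := h.support)]
    · simp_rw [Algebra.smul_def]
      apply S.v_sum_eq_of_lt hi hik
      intro j hj hji
      refine lt_of_le_of_ne (hik ▸ hmin j hj) ?_
      obtain ⟨m, hm⟩ := hval j hj
      rw [hterm, hm]
      have hjn : j < n := lt_of_le_of_lt (le_natDegree_of_mem_supp j hj) hd
      norm_cast
      intro heq
      exact hji (eq_of_int_add_div_eq hin hjn heq).2.symm
    · intro j hj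
      rw [Finset.mem_range]
      exact Nat.lt_succ_of_le (le_natDegree_of_mem_supp j hj)
    · intro j _ hj
      rw [notMem_support_iff.1 hj, zero_smul]
  · by_cases hj : j ∈ h.support
    · rw [← hik, ← hterm]
      exact hmin j hj
    · rw [notMem_support_iff.1 hj, map_zero, S.v_zero, top_add]
      exact le_top

theorem v_root_of_isEisenstein {n : ℕ} (hn : 0 < n) {f : K[X]} (hf : S.IsEisensteinOfDegree f n)
    {α : Ω} (hα : aeval α f = 0) : S.v α = ((1 / n : ℚ) : WithTop ℚ) := by
  classical
  obtain ⟨hmon, hdeg, hge, h0⟩ := hf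
  have hn' : (0 : ℚ) < n := by exact_mod_cast hn
  have hexp : α ^ n + ∑ i ∈ Finset.range n, algebraMap K Ω (f.coeff i) * α ^ i = 0 := by
    rw [aeval_eq_sum_range, hdeg, Finset.sum_range_succ] at hα
    have hl : f.coeff n = 1 := by rw [← hdeg]; exact hmon
    rw [hl, one_smul] at hα
    simp_rw [Algebra.smul_def] at hα
    rw [add_comm]
    exact hα
  have hα0 : α ≠ 0 := by
    rintro rfl
    rw [← coeff_zero_eq_aeval_zero'] at hα
    rw [hα, S.v_zero] at h0
    exact WithTop.top_ne_one h0
  obtain ⟨r, hr⟩ := S.exists_rat hα0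
  have hsum : S.v (∑ i ∈ Finset.range n, algebraMap K Ω (f.coeff i) * α ^ i) =
      ((n * r : ℚ) : WithTop ℚ) := by
    rw [← S.v_pow hr, ← S.v_neg, neg_eq_of_add_eq_zero_left hexp]
  have hterm : ∀ i < n, ((1 + i * r : ℚ) : WithTop ℚ) ≤
      S.v (algebraMap K Ω (f.coeff i) * α ^ i) := fun i hi => by
    rw [S.v_mul, S.v_pow hr]
    exact add_le_add (hge i hi) le_rfl
  have hr0 : 0 < r := by
    by_contra hle
    push Not at hle
    have : ((1 + n * r : ℚ) : WithTop ℚ) ≤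
        S.v (∑ i ∈ Finset.range n, algebraMap K Ω (f.coeff i) * α ^ i) := by
      refine S.le_v_sum fun i hi => ?_
      rw [Finset.mem_range] at hi
      refine le_trans ?_ (hterm i hi)
      have hi' : (i : ℚ) ≤ n := by exact_mod_cast hi.le
      norm_cast
      nlinarith
    rw [hsum] at this
    norm_cast at this
    linarith
  have h1 : S.v (∑ i ∈ Finset.range n, algebraMap K Ω (f.coeff i) * α ^ i) =
      ((1 : ℚ) : WithTop ℚ) := by
    refine S.v_sum_eq_of_lt (j := 0) (Finset.mem_range.2 hn) (by simpa using h0) fun i hi hi0 => ?_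
    rw [Finset.mem_range] at hi
    refine lt_of_lt_of_le ?_ (hterm i hi)
    have hi' : (0 : ℚ) < i := by exact_mod_cast Nat.pos_of_ne_zero hi0
    norm_cast
    nlinarith
  rw [hsum] at h1
  norm_cast at h1
  rw [hr]
  norm_cast
  field_simp
  linarith

theorem le_natDegree_of_aeval_eq_zero {n : ℕ} {α : Ω} (hα : S.v α = ((1 / n : ℚ) : WithTop ℚ))
    {g : K[X]} (hg : g ≠ 0) (h : aeval α g = 0) : n ≤ g.natDegree := by
  by_contra hlt
  push Not at hlt
  obtain ⟨i, -, k, -, hk, -⟩ := S.v_aeval_eq_min hα hg hlt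
  exact S.ne_zero_of_v hk h

theorem minpoly_eq_of_monic {n : ℕ} {α : Ω} (hα : S.v α = ((1 / n : ℚ) : WithTop ℚ))
    {f : K[X]} (hf : f.Monic) (hdeg : f.natDegree = n) (h : aeval α f = 0) : minpoly K α = f := by
  refine (minpoly.unique K α hf h fun q hq hq0 => ?_).symm
  rw [degree_eq_natDegree hf.ne_zero, degree_eq_natDegree hq.ne_zero, hdeg]
  exact_mod_cast S.le_natDegree_of_aeval_eq_zero hα hq.ne_zero hq0

theorem exists_aeval_eq_of_mem_adjoin {α β : Ω} (hα : IsIntegral K α)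
    (hβ : β ∈ IntermediateField.adjoin K {α}) :
    ∃ h : K[X], h.natDegree < (minpoly K α).natDegree ∧ aeval α h = β := by
  have h1 : β ∈ Algebra.adjoin K {α} := by
    rw [← IntermediateField.adjoin_simple_toSubalgebra_of_isAlgebraic hα.isAlgebraic]
    exact hβ
  rw [Algebra.adjoin_singleton_eq_range_aeval] at h1
  obtain ⟨g, rfl⟩ := h1
  refine ⟨g %ₘ minpoly K α, ?_, ?_⟩
  · apply natDegree_modByMonic_lt _ (minpoly.monic hα)
    exact minpoly.ne_one K α
  · exact aeval_modByMonic_eq_self_of_root (minpoly.aeval K α)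

/-- Every uniformizer of a totally ramified extension is a generator whose minimal polynomial
is Eisenstein. -/
theorem isEisenstein_minpoly_of_mem_adjoin {n : ℕ} (hn : 0 < n) {α β : Ω} (hα : IsIntegral K α)
    (hdeg : (minpoly K α).natDegree = n) (hβ : β ∈ IntermediateField.adjoin K {α})
    (hvβ : S.v β = ((1 / n : ℚ) : WithTop ℚ)) :
    IntermediateField.adjoin K {β} = IntermediateField.adjoin K {α} ∧
      S.IsEisensteinOfDegree (minpoly K β) n := by
  have hfin : FiniteDimensional K (IntermediateField.adjoin K {α}) :=
    IntermediateField.adjoin.finiteDimensional hα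
  have hle : IntermediateField.adjoin K {β} ≤ IntermediateField.adjoin K {α} := by
    rw [IntermediateField.adjoin_simple_le_iff]
    exact hβ
  have hintβ : IsIntegral K β := by
    have := IsIntegral.of_finite K (⟨β, hβ⟩ : IntermediateField.adjoin K {α})
    exact this.map (IntermediateField.val _)
  have hge : n ≤ (minpoly K β).natDegree :=
    S.le_natDegree_of_aeval_eq_zero hvβ (minpoly.ne_zero hintβ) (minpoly.aeval K β)
  have heq : IntermediateField.adjoin K {β} = IntermediateField.adjoin K {α} := by
    apply IntermediateField.eq_of_le_of_finrank_le hle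
    rw [IntermediateField.adjoin.finrank hα, IntermediateField.adjoin.finrank hintβ, hdeg]
    exact hge
  have hdegβ : (minpoly K β).natDegree = n := by
    rw [← IntermediateField.adjoin.finrank hintβ, heq, IntermediateField.adjoin.finrank hα, hdeg]
  refine ⟨heq, minpoly.monic hintβ, hdegβ, ?_⟩
  have hn' : (0 : ℚ) < n := by exact_mod_cast hn
  set g := minpoly K β with hg
  have hmon : g.Monic := minpoly.monic hintβ
  set h : K[X] := g.eraseLead with hh
  have hgh : h + X ^ n = g := by
    have := g.eraseLead_add_monomial_natDegree_leadingCoeff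
    rw [hmon.leadingCoeff, hdegβ, monomial_one_right_eq_X_pow] at this
    exact this
  have hval : aeval β h = -β ^ n := by
    have := minpoly.aeval K β
    rw [← hg, ← hgh, map_add, map_pow, aeval_X] at this
    exact eq_neg_of_add_eq_zero_left this
  have hv1 : S.v (aeval β h) = ((1 : ℚ) : WithTop ℚ) := by
    rw [hval, S.v_neg, S.v_pow hvβ]
    congr 1
    field_simp
  have h0 : h ≠ 0 := by
    intro h0
    rw [h0, map_zero] at hv1
    exact S.ne_zero_of_v hv1 rfl
  have hhdeg : h.natDegree < n := by
    rcases g.eraseLead_natDegree_lt_or_eraseLead_eq_zero with h1 | h1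
    · rwa [hdegβ] at h1
    · exact absurd h1 h0
  have hcoeff : ∀ i < n, g.coeff i = h.coeff i := fun i hi => by
    rw [hh, eraseLead_coeff_of_ne]
    omega
  obtain ⟨i, hi, k, hk, hk2, hmin⟩ := S.v_aeval_eq_min hvβ h0 hhdeg
  rw [hv1] at hk2
  have hk3 : (1 : ℚ) = k + i / n := by exact_mod_cast hk2
  rw [← hk3] at hmin
  have hi0 : i = 0 := by
    have h1 : (((1 : ℤ) : ℚ) + (0 : ℕ) / n : ℚ) = k + i / n := by simpa using hk3
    exact (eq_of_int_add_div_eq hn hi h1).2.symm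
  subst hi0
  refine ⟨fun j hj => ?_, ?_⟩
  · rw [hcoeff j hj]
    rcases eq_or_ne (h.coeff j) 0 with hz | hz
    · rw [hz, map_zero, S.v_zero]
      exact le_top
    · obtain ⟨m, hm⟩ := S.v_int _ hz
      have := hmin j
      rw [hm] at this ⊢
      norm_cast at this ⊢
      have hj' : (j : ℚ) / n < 1 := by
        rw [div_lt_one hn']
        exact_mod_cast hj
      have h1 : (0 : ℚ) < m := by linarith
      have h2 : 0 < m := by exact_mod_cast h1
      have h3 : 1 ≤ m := h2
      exact_mod_cast h3
  · rw [hcoeff 0 hn, hk]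
    simp only [Nat.cast_zero, zero_div, add_zero] at hk3
    rw [← hk3]
    rfl

theorem v_aeval_nonneg {α : Ω} (hα : 0 ≤ S.v α) {h : K[X]}
    (hh : ∀ i, 0 ≤ S.v (algebraMap K Ω (h.coeff i))) : 0 ≤ S.v (aeval α h) := by
  rw [aeval_eq_sum_range]
  refine S.le_v_sum fun i _ => ?_
  rw [Algebra.smul_def, S.v_mul, ← addVal_apply, ← addVal_apply, S.addVal.map_pow]
  exact add_nonneg (hh i) (nsmul_nonneg hα i)

/-- The valuation of `f'(α)` does not grow when the uniformizer `α` of a totally ramified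
extension is replaced by another one. -/
theorem v_derivative_minpoly_le (O : Subring K)
    (hO : ∀ x : K, x ∈ O ↔ 0 ≤ S.v (algebraMap K Ω x)) {n : ℕ} (hn : 0 < n) {α β : Ω}
    (hα : S.v α = ((1 / n : ℚ) : WithTop ℚ)) (hβ : S.v β = ((1 / n : ℚ) : WithTop ℚ))
    (hf : S.IsEisensteinOfDegree (minpoly K α) n) (hg : S.IsEisensteinOfDegree (minpoly K β) n)
    (hmem : β ∈ IntermediateField.adjoin K {α}) :
    S.v (aeval α (derivative (minpoly K α))) ≤ S.v (aeval β (derivative (minpoly K β))) := by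
  have hn' : (0 : ℚ) < n := by exact_mod_cast hn
  have hintα : IsIntegral K α := minpoly.ne_zero_iff.1 hf.1.ne_zero
  have hα0 : 0 ≤ S.v α := by
    rw [hα]
    exact_mod_cast (by positivity : (0 : ℚ) ≤ 1 / n)
  have hmonO : ∀ g : K[X], S.IsEisensteinOfDegree g n → (↑g.coeffs : Set K) ⊆ O := by
    intro g hg c hc
    rw [Finset.mem_coe, mem_coeffs_iff] at hc
    obtain ⟨i, hi, rfl⟩ := hc
    rw [SetLike.mem_coe, hO]
    rcases (le_natDegree_of_mem_supp i hi).eq_or_lt with h | h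
    · have : g.coeff i = 1 := by rw [h]; exact hg.1
      rw [this, map_one, S.v_one_s7]
    · exact le_trans zero_le_one (hg.2.2.1 i (hg.2.1 ▸ h))
  obtain hn1 | hn2 : n = 1 ∨ 2 ≤ n := by omega
  · subst hn1
    have hder : ∀ g : K[X], S.IsEisensteinOfDegree g 1 → derivative g = 1 := by
      intro g hg
      rw [hg.1.eq_X_add_C hg.2.1]
      simp
    rw [hder _ hf, hder _ hg]
    simp
  obtain ⟨h, hhdeg, hh⟩ := exists_aeval_eq_of_mem_adjoin hintα hmem
  rw [hf.2.1] at hhdeg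
  have hh0 : h ≠ 0 := by
    rintro rfl
    rw [map_zero] at hh
    exact S.ne_zero_of_v hβ hh.symm
  obtain ⟨i, hi, k, hk, hkv, hmin⟩ := S.v_aeval_eq_min hα hh0 hhdeg
  rw [hh, hβ] at hkv
  have hki : (k + i / n : ℚ) = (0 : ℤ) + (1 : ℕ) / n := by
    have : (1 / n : ℚ) = k + i / n := by exact_mod_cast hkv
    rw [← this]
    simp
  obtain ⟨rfl, rfl⟩ := eq_of_int_add_div_eq hi (by omega) hki
  rw [hki] at hmin
  have hhO : (↑h.coeffs : Set K) ⊆ O := by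
    intro c hc
    rw [Finset.mem_coe, mem_coeffs_iff] at hc
    obtain ⟨j, hj, rfl⟩ := hc
    rw [SetLike.mem_coe, hO]
    have hjn : j < n := lt_of_le_of_lt (le_natDegree_of_mem_supp j hj) hhdeg
    obtain ⟨m, hm⟩ := S.v_int _ (mem_support_iff.1 hj)
    have := hmin j
    rw [hm] at this ⊢
    norm_cast at this ⊢
    have hj' : (j : ℚ) / n < 1 := by
      rw [div_lt_one hn']
      exact_mod_cast hjn
    have h0 : (0 : ℚ) < 1 / n := by positivity
    have h1 : (-1 : ℚ) < m := by
      linarith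
    have h2 : -1 < m := by exact_mod_cast h1
    have h3 : 0 ≤ m := by omega
    exact_mod_cast h3
  set F := (minpoly K α).toSubring O (hmonO _ hf) with hF
  set G := (minpoly K β).toSubring O (hmonO _ hg) with hG
  set H := h.toSubring O hhO with hH
  have hFm : F.map O.subtype = minpoly K α := map_toSubring _ _ _
  have hGm : G.map O.subtype = minpoly K β := map_toSubring _ _ _
  have hHm : H.map O.subtype = h := map_toSubring _ _ _
  have hFmon : F.Monic := (monic_toSubring _ _ _).2 hf.1
  set Q := (G.comp H) /ₘ F with hQ
  have hdiv : ((minpoly K β).comp h) = minpoly K α * Q.map O.subtype := by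
    have h1 := modByMonic_add_div (G.comp H) F
    have h2 := congrArg (Polynomial.map O.subtype) h1
    rw [Polynomial.map_add, Polynomial.map_mul, Polynomial.map_comp, hFm, hGm, hHm] at h2
    have hR : ((G.comp H) %ₘ F).map O.subtype = 0 := by
      by_contra hne
      have hR0 : aeval α (((G.comp H) %ₘ F).map O.subtype) = 0 := by
        have := congrArg (aeval α) h2
        rw [map_add, map_mul, minpoly.aeval, zero_mul, add_zero, aeval_comp, hh,
          minpoly.aeval] at this
        exact this
      have h3 := S.le_natDegree_of_aeval_eq_zero hα hne hR0
      have h4 : ((G.comp H) %ₘ F).natDegree < F.natDegree := by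
        apply natDegree_modByMonic_lt _ hFmon
        intro hF1
        have := hf.2.1
        rw [← hFm, hF1, Polynomial.map_one, natDegree_one] at this
        omega
      rw [hF, natDegree_toSubring, hf.2.1] at h4
      exact absurd (h3.trans natDegree_map_le) (not_le.2 h4)
    rw [hR, zero_add] at h2
    exact h2.symm
  have hder : aeval β (derivative (minpoly K β)) * aeval α (derivative h) =
      aeval α (derivative (minpoly K α)) * aeval α (Q.map O.subtype) := by
    have := congrArg (fun P => aeval α (derivative P)) hdiv
    simp only [derivative_comp, derivative_mul, map_add, map_mul, aeval_comp, hh,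
      minpoly.aeval, zero_mul, add_zero] at this
    rw [mul_comm] at this
    exact this
  have hQv : 0 ≤ S.v (aeval α (Q.map O.subtype)) := by
    refine S.v_aeval_nonneg hα0 fun i => ?_
    rw [coeff_map]
    exact (hO _).1 (Q.coeff i).2
  have hcoef0 : S.v (algebraMap K Ω ((derivative h).coeff 0)) = 0 := by
    rw [coeff_derivative]
    simp only [Nat.cast_zero, zero_add, mul_one]
    rw [hk]
    rfl
  have hhv : S.v (aeval α (derivative h)) ≤ 0 := by
    have hd0 : derivative h ≠ 0 := by
      intro h0
      rw [h0, coeff_zero, map_zero, S.v_zero] at hcoef0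
      exact WithTop.top_ne_zero hcoef0
    obtain ⟨i, -, k, -, hkv, hmin⟩ := S.v_aeval_eq_min hα hd0
      (lt_of_le_of_lt (natDegree_derivative_le h) (by omega))
    rw [hkv]
    have := hmin 0
    rw [hcoef0] at this
    simpa using this
  have hfin := congrArg S.v hder
  rw [S.v_mul, S.v_mul] at hfin
  calc S.v (aeval α (derivative (minpoly K α)))
      ≤ S.v (aeval α (derivative (minpoly K α))) + S.v (aeval α (Q.map O.subtype)) :=
        le_add_of_nonneg_right hQv
    _ = S.v (aeval β (derivative (minpoly K β))) + S.v (aeval α (derivative h)) := hfin.symm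
    _ ≤ _ := by
        simpa using add_le_add_right hhv (S.v (aeval β (derivative (minpoly K β))))

/-- The valuation is invariant under automorphisms, by uniqueness of the extension of the
`p`-adic absolute value. -/
theorem v_algEquiv [Algebra.IsAlgebraic ℚ_[p] Ω] (σ : Ω ≃ₐ[ℚ_[p]] Ω) (x : Ω) :
    S.v (σ x) = S.v x := by
  classical
  have hp1 : (1 : ℝ) < p := by exact_mod_cast (Fact.out : p.Prime).one_lt
  have hp0 : (0 : ℝ) < p := by linarith
  have he : (0 : ℝ) < S.e := by exact_mod_cast S.e_pos
  let N : Ω → ℝ := fun x => if x = 0 then 0 else (p : ℝ) ^ (-(((S.v x).untopD 0 : ℚ) : ℝ) / S.e)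
  have hN0 : N 0 = 0 := if_pos rfl
  have hN : ∀ {x : Ω} {r : ℚ}, S.v x = (r : WithTop ℚ) → N x = (p : ℝ) ^ (-(r : ℝ) / S.e) := by
    intro x r hr
    simp only [N]
    rw [if_neg (S.ne_zero_of_v hr), hr]
    rfl
  have hNnn : ∀ x, 0 ≤ N x := by
    intro x
    simp only [N]
    split_ifs
    · exact le_rfl
    · positivity
  have hNmono : ∀ x y, S.v x ≤ S.v y → N y ≤ N x := by
    intro x y hxy
    rcases eq_or_ne y 0 with rfl | hy
    · rw [hN0]
      exact hNnn x
    obtain ⟨s, hs⟩ := S.exists_rat hy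
    have hx : x ≠ 0 := by
      rintro rfl
      rw [S.v_zero, hs] at hxy
      exact absurd hxy (by simp)
    obtain ⟨r, hr⟩ := S.exists_rat hx
    rw [hN hs, hN hr]
    rw [hr, hs] at hxy
    have hrs : (r : ℝ) ≤ s := by exact_mod_cast hxy
    apply Real.rpow_le_rpow_of_exponent_le hp1.le
    gcongr
  let A : AbsoluteValue Ω ℝ :=
    { toFun := N
      map_mul' := by
        intro x y
        rcases eq_or_ne x 0 with rfl | hx
        · rw [zero_mul, hN0, zero_mul]
        rcases eq_or_ne y 0 with rfl | hy
        · rw [mul_zero, hN0, mul_zero]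
        obtain ⟨r, hr⟩ := S.exists_rat hx
        obtain ⟨s, hs⟩ := S.exists_rat hy
        have hrs : S.v (x * y) = ((r + s : ℚ) : WithTop ℚ) := by
          rw [S.v_mul, hr, hs]
          rfl
        rw [hN hrs, hN hr, hN hs, ← Real.rpow_add hp0]
        congr 1
        push_cast
        ring
      nonneg' := hNnn
      eq_zero' := by
        intro x
        refine ⟨fun h => ?_, fun h => h ▸ hN0⟩
        by_contra hx
        obtain ⟨r, hr⟩ := S.exists_rat hx
        have h' : N x = 0 := h
        rw [hN hr] at h'
        exact (Real.rpow_pos_of_pos hp0 _).ne' h'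
      add_le' := by
        intro x y
        rcases min_le_iff.1 (S.v_add x y) with h | h
        · exact (hNmono _ _ h).trans (le_add_of_nonneg_right (hNnn y))
        · exact (hNmono _ _ h).trans (le_add_of_nonneg_left (hNnn x)) }
  have hext : ∀ x : ℚ_[p], A (algebraMap ℚ_[p] Ω x) = ‖x‖ := by
    intro x
    change N _ = _
    rcases eq_or_ne x 0 with rfl | hx
    · rw [map_zero, hN0, norm_zero]
    rw [hN (S.v_padic x hx), Padic.norm_eq_zpow_neg_valuation hx, ← Real.rpow_intCast]
    congr 1
    push_cast
    field_simp
  have hinv : N (σ x) = N x := by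
    have h1 := spectralNorm_unique_field_norm_ext hext x
    have h2 := spectralNorm_unique_field_norm_ext hext (σ x)
    rw [← spectralNorm_eq_of_equiv, ← h1] at h2
    exact h2
  rcases eq_or_ne x 0 with rfl | hx
  · rw [map_zero]
  obtain ⟨r, hr⟩ := S.exists_rat hx
  obtain ⟨s, hs⟩ := S.exists_rat ((map_ne_zero σ).2 hx)
  rw [hN hr, hN hs, Real.rpow_right_inj hp0 hp1.ne'] at hinv
  rw [hr, hs]
  have : (r : ℝ) = s := by
    field_simp at hinv
    linarith
  have h2 : r = s := by exact_mod_cast this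
  rw [h2]

/-- Krasner's lemma: an element closer to `α` than all other conjugates of `α` generates a field
containing `α`. -/
theorem mem_adjoin_of_krasner [Algebra.IsAlgebraic ℚ_[p] Ω] [IsAlgClosed Ω]
    [Algebra.IsAlgebraic K Ω] {α β : Ω}
    (h : ∀ α', aeval α' (minpoly K α) = 0 → α' ≠ α → S.v (α - α') < S.v (α - β)) :
    α ∈ IntermediateField.adjoin K {β} := by
  have : CharZero K := charZero_of_injective_algebraMap (algebraMap ℚ_[p] K).injective
  set L := IntermediateField.adjoin K {β} with hL
  have : Algebra.IsAlgebraic L Ω := Algebra.IsAlgebraic.tower_top (K := K) L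
  have : IsAlgClosure L Ω := ⟨inferInstance, inferInstance⟩
  have : IsGalois L Ω := inferInstance
  suffices hfix : α ∈ Set.range (algebraMap L Ω) by
    obtain ⟨y, rfl⟩ := hfix
    exact y.2
  rw [InfiniteGalois.mem_range_algebraMap_iff_fixed]
  intro σ
  by_contra hne
  have hβ : σ β = β := σ.commutes ⟨β, IntermediateField.mem_adjoin_simple_self K β⟩
  have hroot : aeval (σ α) (minpoly K α) = 0 := by
    have := (aeval_algHom_apply (σ.restrictScalars K) α (minpoly K α))
    rw [minpoly.aeval, map_zero] at this
    exact this
  have h1 := h _ hroot hne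
  let τ : Ω ≃ₐ[ℚ_[p]] Ω := AlgEquiv.ofRingEquiv (f := σ.toRingEquiv) (by
    intro x
    have : algebraMap ℚ_[p] Ω x = algebraMap L Ω (algebraMap K L (algebraMap ℚ_[p] K x)) := by
      rw [← IsScalarTower.algebraMap_apply K L Ω, ← IsScalarTower.algebraMap_apply ℚ_[p] K Ω]
    rw [this]
    exact σ.commutes _)
  have h2 : S.v (σ α - β) = S.v (α - β) := by
    rw [← S.v_algEquiv τ (α - β)]
    change _ = S.v (σ (α - β))
    rw [map_sub, hβ]
  have h3 : S.v (α - β) ≤ S.v (α - σ α) := by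
    have : α - σ α = (α - β) - (σ α - β) := by ring
    rw [this]
    exact S.le_v_sub le_rfl h2.ge
  exact absurd h1 (not_lt.2 h3)

theorem v_natCast_nonneg (m : ℕ) : 0 ≤ S.v (m : Ω) := by
  induction m with
  | zero => simp [S.v_zero]
  | succ m ih =>
    rw [Nat.cast_succ]
    exact S.le_v_add ih S.v_one_s7.ge

section Roots

theorem nodup_aroots_of_separable {f : K[X]} (hsep : f.Separable) : (f.aroots Ω).Nodup :=
  nodup_roots hsep.map

theorem mem_rootFinset_iff [DecidableEq Ω] {f : K[X]} (hf : f.Monic) {α : Ω} :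
    α ∈ (f.aroots Ω).toFinset ↔ aeval α f = 0 := by
  rw [Multiset.mem_toFinset, mem_aroots]
  exact and_iff_right hf.ne_zero

variable [IsAlgClosed Ω]

theorem separable_of_isEisenstein {n : ℕ} (hn : 0 < n) {f : K[X]}
    (hf : S.IsEisensteinOfDegree f n) : f.Separable := by
  have : CharZero K := charZero_of_injective_algebraMap (algebraMap ℚ_[p] K).injective
  obtain ⟨α, hα⟩ := IsAlgClosed.exists_aeval_eq_zero Ω f
    (by rw [degree_eq_natDegree hf.1.ne_zero, hf.2.1]; exact_mod_cast hn.ne')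
  have hint : IsIntegral K α := ⟨f, hf.1, hα⟩
  rw [← S.minpoly_eq_of_monic (S.v_root_of_isEisenstein hn hf hα) hf.1 hf.2.1 hα]
  exact (minpoly.irreducible hint).separable

variable [DecidableEq Ω]

theorem card_rootFinset {f : K[X]} (hsep : f.Separable) :
    (f.aroots Ω).toFinset.card = f.natDegree := by
  rw [Multiset.toFinset_card_of_nodup (nodup_aroots_of_separable hsep),
    ← (IsAlgClosed.splits (f.map (algebraMap K Ω))).natDegree_eq_card_roots, natDegree_map]

theorem aeval_eq_prod_rootFinset {f : K[X]} (hf : f.Monic) (hsep : f.Separable) (x : Ω) :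
    aeval x f = ∏ β ∈ (f.aroots Ω).toFinset, (x - β) := by
  rw [(IsAlgClosed.splits (f.map (algebraMap K Ω))).aeval_eq_prod_aroots_of_monic hf,
    Finset.prod_multiset_map_count]
  refine Finset.prod_congr rfl fun β hβ => ?_
  rw [Multiset.count_eq_one_of_mem (nodup_aroots_of_separable hsep) (Multiset.mem_toFinset.1 hβ),
    pow_one]

theorem aeval_derivative_eq_prod_rootFinset {f : K[X]} (hf : f.Monic) (hsep : f.Separable) {β : Ω}
    (hβ : aeval β f = 0) :
    aeval β (derivative f) = ∏ β' ∈ (f.aroots Ω).toFinset.erase β, (β - β') := by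
  have hmem := (mem_rootFinset_iff hf).2 hβ
  have h1 := (IsAlgClosed.splits (f.map (algebraMap K Ω))).eval_root_derivative
    (hf.map _) (Multiset.mem_toFinset.1 hmem)
  rw [derivative_map, eval_map_algebraMap] at h1
  have hnd := nodup_aroots_of_separable (Ω := Ω) hsep
  rw [h1, Finset.prod, Finset.erase_val, Multiset.toFinset_val, hnd.dedup]

/-- The distance between two roots of an Eisenstein polynomial is bounded by its derivative. -/
theorem v_sub_root_le_v_derivative {n : ℕ} (hn : 0 < n) {f : K[X]} (hf : S.IsEisensteinOfDegree f n)
    {α α' : Ω} (hα : aeval α f = 0) (hα' : aeval α' f = 0) (hne : α' ≠ α) : S.v (α - α') ≤ S.v (aeval α (derivative f)) := by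
  have hsep := S.separable_of_isEisenstein hn hf
  rw [aeval_derivative_eq_prod_rootFinset hf.1 hsep hα,
    ← Finset.mul_prod_erase _ _ (Finset.mem_erase.2 ⟨hne, (mem_rootFinset_iff hf.1).2 hα'⟩), S.v_mul]
  refine le_add_of_nonneg_right (S.v_finset_prod_nonneg _ _ fun β hβ => ?_)
  have hβ0 := (mem_rootFinset_iff hf.1).1 (Finset.mem_of_mem_erase (Finset.mem_of_mem_erase hβ))
  have hn0 : (0 : WithTop ℚ) ≤ ((1 / n : ℚ) : WithTop ℚ) := by
    exact_mod_cast (by positivity : (0 : ℚ) ≤ 1 / n)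
  exact S.le_v_sub ((S.v_root_of_isEisenstein hn hf hα).symm ▸ hn0)
    ((S.v_root_of_isEisenstein hn hf hβ0).symm ▸ hn0)

/-- Near any element there is a root of `f` at the distance prescribed by Newton's method. -/
theorem exists_root_near {n : ℕ} (hn : 0 < n) {f : K[X]} (hf : S.IsEisensteinOfDegree f n)
    (x : Ω) : ∃ β, aeval β f = 0 ∧
      S.v (aeval x f) ≤ S.v (x - β) + S.v (aeval β (derivative f)) := by
  have hsep := S.separable_of_isEisenstein hn hf
  obtain ⟨β, hβ, hmax⟩ := (f.aroots Ω).toFinset.exists_max_image (fun β => S.v (x - β)) (by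
    rw [← Finset.card_pos, card_rootFinset hsep, hf.2.1]
    exact hn)
  have hβ0 := (mem_rootFinset_iff hf.1).1 hβ
  refine ⟨β, hβ0, ?_⟩
  rw [aeval_derivative_eq_prod_rootFinset hf.1 hsep hβ0, aeval_eq_prod_rootFinset hf.1 hsep,
    ← Finset.mul_prod_erase _ _ hβ, S.v_mul]
  gcongr
  refine S.v_finset_prod_le _ _ _ fun β' hβ' => ?_
  have h1 : β - β' = (x - β') - (x - β) := by ring
  rw [h1]
  exact S.le_v_sub le_rfl (hmax β' (Finset.mem_of_mem_erase hβ'))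

/-- If `x` is close enough to a root of `f`, then `f(x)` is as small as Newton's method predicts. -/
theorem v_sub_add_v_derivative_le {n : ℕ} (hn : 0 < n) {f : K[X]} (hf : S.IsEisensteinOfDegree f n)
    {β : Ω} (hβ : aeval β f = 0) {x : Ω}
    (hx : S.v (aeval β (derivative f)) ≤ S.v (x - β)) :
    S.v (x - β) + S.v (aeval β (derivative f)) ≤ S.v (aeval x f) := by
  have hsep := S.separable_of_isEisenstein hn hf
  rw [aeval_derivative_eq_prod_rootFinset hf.1 hsep hβ]
  rw [aeval_eq_prod_rootFinset hf.1 hsep,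
    ← Finset.mul_prod_erase _ _ ((mem_rootFinset_iff hf.1).2 hβ), S.v_mul]
  gcongr
  refine S.v_finset_prod_le _ _ _ fun β' hβ' => ?_
  rw [Finset.mem_erase, mem_rootFinset_iff hf.1] at hβ'
  have h1 : x - β' = (x - β) + (β - β') := by ring
  rw [h1]
  exact S.le_v_add ((S.v_sub_root_le_v_derivative hn hf hβ hβ'.2 hβ'.1).trans hx) le_rfl

end Roots

theorem coe_mul_eq_coe_iff {a b : ℚ} (ha : 0 < a) (x : WithTop ℚ) :
    (a : WithTop ℚ) * x = (b : WithTop ℚ) ↔ x = ((b / a : ℚ) : WithTop ℚ) := by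
  induction x using WithTop.recTopCoe with
  | top =>
    rw [WithTop.mul_top (by exact_mod_cast ha.ne')]
    simp
  | coe r =>
    norm_cast
    rw [eq_div_iff ha.ne', mul_comm]

/-- Ore's conditions in terms of integers. -/
theorem ore_conditions_int {w : ℕ → ℤ}
    (hw : ∀ m : ℕ, 0 < m → ((w m : ℚ) : WithTop ℚ) = S.v (algebraMap K Ω (m : K)))
    {n J₀ a₀ b₀ : ℕ} (hn : 0 < n) (hJ : J₀ = a₀ * n + b₀) (hb : b₀ < n)
    (hOre : min (((n : ℚ) : WithTop ℚ) * S.v (algebraMap K Ω (b₀ : K)))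
          (((n : ℚ) : WithTop ℚ) * S.v (algebraMap K Ω (n : K)))
        ≤ ((J₀ : ℚ) : WithTop ℚ)
      ∧ ((J₀ : ℚ) : WithTop ℚ) ≤ ((n : ℚ) : WithTop ℚ) * S.v (algebraMap K Ω (n : K))) :
    (b₀ = 0 → (a₀ : ℤ) = w n) ∧ (b₀ ≠ 0 → w b₀ ≤ a₀) ∧ (a₀ : ℤ) * n + b₀ ≤ n * w n := by
  obtain ⟨h1, h2⟩ := hOre
  rw [← hw n hn] at h1 h2
  have hn' : (0 : ℤ) < n := by exact_mod_cast hn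
  have h2' : (J₀ : ℤ) ≤ n * w n := by exact_mod_cast h2
  subst hJ
  push_cast at h2'
  refine ⟨fun hb0 => ?_, fun hb0 => ?_, h2'⟩
  · subst hb0
    rw [min_le_iff] at h1
    rcases h1 with h1 | h1
    · rw [Nat.cast_zero, map_zero, S.v_zero, WithTop.mul_top (by exact_mod_cast hn.ne')] at h1
      exact absurd h1 (not_le.2 (WithTop.coe_lt_top _))
    · have h1' : (n : ℤ) * w n ≤ (a₀ * n + 0 : ℕ) := by exact_mod_cast h1
      push_cast at h1' h2'
      apply le_antisymm
      · nlinarith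
      · nlinarith
  · rw [min_le_iff] at h1
    rcases h1 with h1 | h1
    · rw [← hw b₀ (Nat.pos_of_ne_zero hb0)] at h1
      have h1' : (n : ℤ) * w b₀ ≤ (a₀ * n + b₀ : ℕ) := by exact_mod_cast h1
      push_cast at h1'
      have hb' : (b₀ : ℤ) < n := by exact_mod_cast hb
      have h3 : w b₀ < a₀ + 1 := by
        by_contra hlt
        push Not at hlt
        nlinarith
      omega
    · exfalso
      have h1' : (n : ℤ) * w n ≤ (a₀ * n + b₀ : ℕ) := by exact_mod_cast h1
      push_cast at h1'
      have h3 : (a₀ : ℤ) * n + b₀ = w n * n + 0 := by linarith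
      have hn0 : (n : ℚ) ≠ 0 := by exact_mod_cast hn.ne'
      have h4 : (((a₀ : ℤ) : ℚ) + b₀ / n : ℚ) = w n + (0 : ℕ) / n := by
        field_simp
        push_cast
        have : (a₀ : ℚ) * n + b₀ = w n * n + 0 := by exact_mod_cast h3
        linarith
      exact hb0 (eq_of_int_add_div_eq hb hn h4).2

/-- Ore's lemma: the valuation of the different of an Eisenstein polynomial in terms of its
coefficients. -/
theorem v_derivative_eq_iff {w : ℕ → ℤ}
    (hw : ∀ m : ℕ, 0 < m → ((w m : ℚ) : WithTop ℚ) = S.v (algebraMap K Ω (m : K)))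
    {n a₀ b₀ : ℕ} (hn : 0 < n) (hb : b₀ < n) (h1 : b₀ = 0 → (a₀ : ℤ) = w n)
    (h2 : b₀ ≠ 0 → w b₀ ≤ a₀) (h3 : (a₀ : ℤ) * n + b₀ ≤ n * w n)
    {l : ℕ → ℤ}
    (hl : ∀ i, l i = if i < b₀ then max (2 + (a₀ : ℤ) - w i) 1 else max (1 + (a₀ : ℤ) - w i) 1)
    {f : K[X]} (hf : S.IsEisensteinOfDegree f n) {α : Ω} (hα : aeval α f = 0) :
    S.v (aeval α (derivative f)) = (((n + (a₀ * n + b₀) - 1) / n : ℚ) : WithTop ℚ) ↔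
      (∀ i, 1 ≤ i → i < n → ((l i : ℚ) : WithTop ℚ) ≤ S.v (algebraMap K Ω (f.coeff i))) ∧
      (b₀ ≠ 0 → S.v (algebraMap K Ω (f.coeff b₀)) = ((l b₀ : ℚ) : WithTop ℚ)) := by
  have : CharZero K := charZero_of_injective_algebraMap (algebraMap ℚ_[p] K).injective
  have hn' : (0 : ℚ) < n := by exact_mod_cast hn
  have hvα := S.v_root_of_isEisenstein hn hf hα
  set δ : ℚ := (n + (a₀ * n + b₀) - 1) / n with hδ
  have hlead : f.coeff n = 1 := by rw [← hf.2.1]; exact hf.1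
  have hcoeff : ∀ i, S.v (algebraMap K Ω ((derivative f).coeff i)) =
      ((w (i + 1) : ℚ) : WithTop ℚ) + S.v (algebraMap K Ω (f.coeff (i + 1))) := fun i => by
    rw [coeff_derivative, mul_comm, map_mul, S.v_mul, hw _ i.succ_pos]
    push_cast
    rfl
  have hd0 : derivative f ≠ 0 := by
    intro h0
    have h4 := derivative_eq_zero.1 h0
    rw [hf.2.1] at h4
    omega
  obtain ⟨i, hi, k, hk, hkv, hmin⟩ := S.v_aeval_eq_min hvα hd0
    (lt_of_le_of_lt (natDegree_derivative_le f) (by rw [hf.2.1]; omega))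
  have hdle : (derivative f).natDegree ≤ n - 1 := by
    have := natDegree_derivative_le f
    rwa [hf.2.1] at this
  -- Clearing denominators in the bound on a single coefficient.
  have hbound : ∀ j, 1 ≤ j → j < n → ∀ c : ℤ,
      ((δ ≤ (w j : ℚ) + c + (j - 1 : ℕ) / n) ∧ 1 ≤ c ↔ l j ≤ c) := by
    intro j hj1 hjn c
    have hj : (((j - 1 : ℕ) : ℤ) : ℚ) = ((j : ℤ) - 1 : ℤ) := by
      congr 1
      omega
    have h4 : δ ≤ (w j : ℚ) + c + (j - 1 : ℕ) / n ↔
        (n : ℤ) + (a₀ * n + b₀) - 1 ≤ (w j + c) * n + (j - 1) := by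
      rw [hδ, div_le_iff₀ hn', add_mul, div_mul_cancel₀ _ hn'.ne']
      have : ((j - 1 : ℕ) : ℚ) = ((j : ℤ) - 1 : ℤ) := by exact_mod_cast hj
      rw [this]
      exact_mod_cast Iff.rfl
    rw [h4, hl]
    split_ifs with hjb
    · rw [max_le_iff]
      refine and_congr_left fun _ => ⟨fun h => ?_, fun h => ?_⟩
      · by_contra hlt
        push Not at hlt
        have : (w j + c) * (n : ℤ) ≤ (1 + a₀) * n := mul_le_mul_of_nonneg_right (by omega) (by positivity)
        have hjb' : (j : ℤ) < b₀ := by exact_mod_cast hjb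
        linarith
      · have : (2 + a₀ : ℤ) * n ≤ (w j + c) * n := mul_le_mul_of_nonneg_right (by omega) (by positivity)
        have hb' : (b₀ : ℤ) < n := by exact_mod_cast hb
        have hj1' : (1 : ℤ) ≤ j := by exact_mod_cast hj1
        linarith
    · rw [max_le_iff]
      refine and_congr_left fun _ => ⟨fun h => ?_, fun h => ?_⟩
      · by_contra hlt
        push Not at hlt
        have : (w j + c) * (n : ℤ) ≤ (a₀ : ℤ) * n := mul_le_mul_of_nonneg_right (by omega) (by positivity)
        have hjn' : (j : ℤ) < n := by exact_mod_cast hjn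
        have hb' : (0 : ℤ) ≤ b₀ := by positivity
        linarith
      · have : (1 + a₀ : ℤ) * n ≤ (w j + c) * n := mul_le_mul_of_nonneg_right (by omega) (by positivity)
        have hjb' : (b₀ : ℤ) ≤ j := by exact_mod_cast not_lt.1 hjb
        linarith
  have hlb : b₀ ≠ 0 → l b₀ = 1 + a₀ - w b₀ := fun hb0 => by
    have := h2 hb0
    rw [hl, if_neg (lt_irrefl _), max_eq_left]
    omega
  constructor
  · intro hv
    have hki : (k + i / n : ℚ) = δ := by
      rw [hkv] at hv
      exact_mod_cast hv
    rw [hki] at hmin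
    refine ⟨fun j hj1 hjn => ?_, fun hb0 => ?_⟩
    · rcases eq_or_ne (f.coeff j) 0 with h0 | h0
      · rw [h0, map_zero, S.v_zero]
        exact le_top
      obtain ⟨c, hc⟩ := S.v_int _ h0
      have h5 := hmin (j - 1)
      rw [hcoeff, Nat.sub_add_cancel hj1, hc] at h5
      have h6 := hf.2.2.1 j hjn
      rw [hc] at h6 ⊢
      norm_cast at h5 h6 ⊢
      have h7 : (1 : ℤ) ≤ c := by exact_mod_cast h6
      exact_mod_cast (hbound j hj1 hjn c).1 ⟨by exact_mod_cast h5, h7⟩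
    · have hb1 : 1 ≤ b₀ := Nat.one_le_iff_ne_zero.2 hb0
      have h5 : (k + i / n : ℚ) = (1 + a₀ : ℤ) + (b₀ - 1 : ℕ) / n := by
        rw [hki, hδ]
        push_cast [Nat.cast_sub hb1]
        field_simp
        ring
      obtain ⟨rfl, rfl⟩ := eq_of_int_add_div_eq hi (by omega) h5
      rw [hcoeff, Nat.sub_add_cancel hb1] at hk
      have h0 : f.coeff b₀ ≠ 0 := by
        intro h0
        rw [h0, map_zero, S.v_zero, add_top] at hk
        exact WithTop.top_ne_coe hk
      obtain ⟨c, hc⟩ := S.v_int _ h0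
      rw [hc] at hk ⊢
      norm_cast at hk ⊢
      rw [hlb hb0]
      omega
  · rintro ⟨hge, hbeq⟩
    have hlow : δ ≤ k + i / n := by
      rw [hcoeff] at hk
      have h0 : f.coeff (i + 1) ≠ 0 := by
        intro h0
        rw [h0, map_zero, S.v_zero, add_top] at hk
        exact WithTop.top_ne_coe hk
      obtain ⟨c, hc⟩ := S.v_int _ h0
      rw [hc] at hk
      have hkc : (w (i + 1) + c : ℤ) = k := by exact_mod_cast hk
      rw [← hkc]
      rcases Nat.lt_or_ge (i + 1) n with hin | hin
      · have h5 := hge (i + 1) (by omega) hin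
        rw [hc] at h5
        have h6 := ((hbound (i + 1) (by omega) hin c).2 (by exact_mod_cast h5)).1
        rw [Nat.add_sub_cancel] at h6
        exact_mod_cast h6
      · have hin' : i + 1 = n := by omega
        rw [hin'] at hc hkc ⊢
        rw [hlead, map_one, S.v_one_s7] at hc
        have hc0 : c = 0 := by exact_mod_cast hc.symm
        have hi' : (i : ℚ) = n - 1 := by
          rw [← hin']
          push_cast
          ring
        have h3' : (a₀ : ℚ) * n + b₀ ≤ n * w n := by exact_mod_cast h3
        rw [hc0, hi', hδ]
        field_simp
        push_cast
        linarith
    have hup : (k + i / n : ℚ) ≤ δ := by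
      rcases Nat.eq_zero_or_pos b₀ with hb0 | hb1
      · have h5 := hmin (n - 1)
        rw [hcoeff, Nat.sub_add_cancel hn, hlead, map_one, S.v_one_s7, add_zero, ← h1 hb0] at h5
        have h6 : (k + i / n : ℚ) ≤ a₀ + (n - 1 : ℕ) / n := by exact_mod_cast h5
        refine h6.trans (le_of_eq ?_)
        rw [hδ, hb0]
        push_cast [Nat.cast_sub (Nat.succ_le_of_lt hn)]
        field_simp
        ring
      · have h5 := hmin (b₀ - 1)
        rw [hcoeff, Nat.sub_add_cancel hb1, hbeq hb1.ne', hlb hb1.ne'] at h5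
        have h6 : (k + i / n : ℚ) ≤ w b₀ + (1 + a₀ - w b₀ : ℤ) + (b₀ - 1 : ℕ) / n := by
          exact_mod_cast h5
        refine h6.trans (le_of_eq ?_)
        rw [hδ]
        push_cast [Nat.cast_sub (Nat.succ_le_of_lt hb1)]
        field_simp
        ring
    rw [hkv]
    exact_mod_cast le_antisymm hup hlow

theorem v_padic_nonneg (x : ℤ_[p]) : 0 ≤ S.v (algebraMap K Ω (algebraMap ℚ_[p] K x)) := by
  rw [← IsScalarTower.algebraMap_apply]
  rcases eq_or_ne x 0 with rfl | hx
  · simp [S.v_zero]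
  · rw [S.v_padic _ fun h => hx (Subtype.ext h)]
    have h : 0 ≤ (x : ℚ_[p]).valuation := Padic.norm_le_one_iff_val_nonneg _ |>.1 x.2
    exact_mod_cast mul_nonneg (Int.natCast_nonneg S.e) h

theorem v_padic_pos {x : ℤ_[p]} (hx : x ∈ IsLocalRing.maximalIdeal ℤ_[p]) :
    0 < S.v (algebraMap K Ω (algebraMap ℚ_[p] K x)) := by
  rw [← IsScalarTower.algebraMap_apply]
  rcases eq_or_ne x 0 with rfl | hx0
  · simp [S.v_zero]
  · have hx0' : (x : ℚ_[p]) ≠ 0 := fun h => hx0 (Subtype.ext h)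
    rw [S.v_padic _ hx0']
    have h : ‖(x : ℚ_[p])‖ < 1 := PadicInt.mem_nonunits.1 hx
    have h2 : 0 < (x : ℚ_[p]).valuation := by
      by_contra hle
      rw [Padic.norm_eq_zpow_neg_valuation hx0'] at h
      exact absurd h (not_lt.2 (one_le_zpow₀ (by exact_mod_cast (Fact.out : p.Prime).one_le)
        (by omega)))
    exact_mod_cast mul_pos (Int.natCast_pos.2 S.e_pos) h2

/-- The residue field of a finite extension of `ℚ_[p]` is finite. -/
theorem finite_residue [FiniteDimensional ℚ_[p] K] (O : Subring K)
    (hO : ∀ x : K, x ∈ O ↔ 0 ≤ S.v (algebraMap K Ω x))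
    (P : Ideal O) (hP : ∀ x : O, x ∈ P ↔ 0 < S.v (algebraMap K Ω (x : K))) :
    Finite (O ⧸ P) := by
  let φ : ℤ_[p] →+* O := ((algebraMap ℚ_[p] K).comp PadicInt.Coe.ringHom).codRestrict O
    fun x => (hO _).2 (S.v_padic_nonneg x)
  let ψ : IsLocalRing.ResidueField ℤ_[p] →+* O ⧸ P :=
    Ideal.Quotient.lift _ ((Ideal.Quotient.mk P).comp φ) fun x hx =>
      Ideal.Quotient.eq_zero_iff_mem.2 ((hP _).2 (S.v_padic_pos hx))
  let _ : Module (IsLocalRing.ResidueField ℤ_[p]) (O ⧸ P) := ψ.toModule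
  have : Finite (IsLocalRing.ResidueField ℤ_[p]) := Finite.of_equiv _ PadicInt.residueField.symm.toEquiv
  have hrank : Module.rank (IsLocalRing.ResidueField ℤ_[p]) (O ⧸ P) ≤ Module.finrank ℚ_[p] K := by
    refine rank_le fun s hs => ?_
    choose x hx using fun i : s => Ideal.Quotient.mk_surjective (i : O ⧸ P)
    have hli : LinearIndependent ℚ_[p] fun i : s => (x i : K) := by
      rw [Fintype.linearIndependent_iff] at hs ⊢
      intro g hg
      by_contra! hne
      obtain ⟨i₁, hi₁⟩ := hne
      obtain ⟨i₀, -, hi₀⟩ := Finset.exists_max_image Finset.univ (fun i => ‖g i‖) ⟨i₁, Finset.mem_univ _⟩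
      have hg0 : g i₀ ≠ 0 := norm_pos_iff.1 ((norm_pos_iff.2 hi₁).trans_le (hi₀ _ (Finset.mem_univ _)))
      let a : s → ℤ_[p] := fun i => ⟨g i / g i₀, by
        rw [norm_div]
        exact div_le_one_of_le₀ (hi₀ i (Finset.mem_univ _)) (norm_nonneg _)⟩
      have ha : ∑ i, φ (a i) * x i = 0 := by
        apply Subtype.ext
        have : ∀ i, ((φ (a i) * x i : O) : K) = (g i₀)⁻¹ • (g i • (x i : K)) := fun i => by
          rw [smul_smul, Algebra.smul_def, inv_mul_eq_div]
          rfl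
        rw [AddSubmonoidClass.coe_finsetSum, Finset.sum_congr rfl fun i _ => this i,
          ← Finset.smul_sum, hg, smul_zero]
        rfl
      have h0 := hs (fun i => IsLocalRing.residue _ (a i)) (by
        rw [← map_zero (Ideal.Quotient.mk P), ← ha, map_sum]
        refine Finset.sum_congr rfl fun i _ => ?_
        rw [map_mul, hx]
        rfl) i₀
      rw [IsLocalRing.residue_eq_zero_iff] at h0
      have h1 : a i₀ = 1 := Subtype.ext (div_self hg0)
      rw [h1] at h0
      exact (Ideal.ne_top_iff_one _).1 (IsLocalRing.maximalIdeal.isMaximal _).ne_top h0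
    simpa using hli.fintype_card_le_finrank
  have : Module.Finite (IsLocalRing.ResidueField ℤ_[p]) (O ⧸ P) :=
    Module.rank_lt_aleph0_iff.1 (hrank.trans_lt Cardinal.natCast_lt_aleph0)
  exact Module.finite_of_finite (IsLocalRing.ResidueField ℤ_[p])

theorem two_le_card_residue [FiniteDimensional ℚ_[p] K] (O : Subring K)
    (hO : ∀ x : K, x ∈ O ↔ 0 ≤ S.v (algebraMap K Ω x))
    (P : Ideal O) (hP : ∀ x : O, x ∈ P ↔ 0 < S.v (algebraMap K Ω (x : K))) :
    2 ≤ Nat.card (O ⧸ P) := by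
  have := S.finite_residue O hO P hP
  have : Nontrivial (O ⧸ P) := Ideal.Quotient.nontrivial_iff.2 <| (Ideal.ne_top_iff_one P).2 fun h => by
    have := (hP 1).1 h
    rw [OneMemClass.coe_one, map_one, S.v_one_s7] at this
    exact lt_irrefl _ this
  exact Finite.one_lt_card

end PadicSetup

namespace AddSubgroup

variable {G : Type*} [AddCommGroup G] {I : ℤ → AddSubgroup G} {q : ℕ}

theorem relIndex_chain (hI : Antitone I) (hq : ∀ k, (I (k + 1)).relIndex (I k) = q) (a : ℤ) (t : ℕ) :
    (I (a + t)).relIndex (I a) = q ^ t := by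
  induction t with
  | zero => simp
  | succ t ih =>
    rw [← relIndex_mul_relIndex _ (I (a + t)) _ (hI (by push_cast; omega)) (hI (by omega)), ih, pow_succ',
      Nat.cast_succ, ← add_assoc, hq]

theorem ncard_mk_image_chain (hI : Antitone I) (hq : ∀ k, (I (k + 1)).relIndex (I k) = q)
    {H : AddSubgroup G} {a b : ℤ} (hab : a ≤ b) (hH : H ⊓ I a = I b) :
    ((QuotientAddGroup.mk : G → G ⧸ H) '' (I a)).ncard = q ^ (b - a).toNat := by
  have h1 := relIndex_ker (I a) (QuotientAddGroup.mk' H)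
  rw [QuotientAddGroup.ker_mk', ← inf_relIndex_right, hH] at h1
  have h2 := relIndex_chain hI hq a (b - a).toNat
  rw [Int.toNat_of_nonneg (by omega), add_sub_cancel] at h2
  rw [← h2, h1]
  rfl

theorem ncard_mk_image_chain_diff (hI : Antitone I) (hq : ∀ k, (I (k + 1)).relIndex (I k) = q)
    (hq0 : q ≠ 0) {H : AddSubgroup G} {a b : ℤ} (hab : a < b) (hH : H ⊓ I a = I b) :
    (((QuotientAddGroup.mk : G → G ⧸ H) '' ((I a : Set G) \ I (a + 1))).ncard : ℚ) =
      (q : ℚ) ^ (b - a) - (q : ℚ) ^ (b - a - 1) := by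
  have hH' : H ⊓ I (a + 1) = I b := le_antisymm
    ((inf_le_inf_left _ (hI (by omega))).trans hH.le)
    (le_inf (hH.ge.trans inf_le_left) (hI (by omega)))
  have hc := ncard_mk_image_chain hI hq hab.le hH
  have hc' := ncard_mk_image_chain hI hq (by omega : a + 1 ≤ b) hH'
  have hdiff : (QuotientAddGroup.mk : G → G ⧸ H) '' ((I a : Set G) \ I (a + 1)) =
      (QuotientAddGroup.mk '' (I a : Set G)) \ (QuotientAddGroup.mk '' (I (a + 1) : Set G)) := by
    apply Set.Subset.antisymm
    · rintro _ ⟨x, ⟨hx, hx'⟩, rfl⟩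
      refine ⟨⟨x, hx, rfl⟩, ?_⟩
      rintro ⟨y, hy, hyx⟩
      have h1 : -y + x ∈ I b := hH ▸ ⟨QuotientAddGroup.eq.1 hyx,
        (I a).add_mem ((I a).neg_mem (hI (by omega) hy)) hx⟩
      refine hx' ?_
      have := add_mem hy (hI (by omega : a + 1 ≤ b) h1)
      rwa [add_neg_cancel_left] at this
    · rintro _ ⟨⟨x, hx, rfl⟩, hx'⟩
      exact ⟨x, ⟨hx, fun h => hx' ⟨x, h, rfl⟩⟩, rfl⟩
  have hfin : (QuotientAddGroup.mk '' (I (a + 1) : Set G) : Set (G ⧸ H)).Finite :=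
    Set.finite_of_ncard_ne_zero (by rw [hc']; exact pow_ne_zero _ hq0)
  have hfin' : (QuotientAddGroup.mk '' (I a : Set G) : Set (G ⧸ H)).Finite :=
    Set.finite_of_ncard_ne_zero (by rw [hc]; exact pow_ne_zero _ hq0)
  rw [hdiff, Set.cast_ncard_sdiff (Set.image_mono (hI (by omega))) hfin', hc, hc']
  push_cast
  rw [← zpow_natCast, ← zpow_natCast, Int.toNat_of_nonneg (by omega), Int.toNat_of_nonneg (by omega),
    sub_sub]

end AddSubgroup

namespace PadicSetup

open IntermediateField

variable (S : PadicSetup p K Ω)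

/-- The elements of an intermediate field of valuation at least `r`. -/
def level (L : IntermediateField K Ω) (r : ℚ) : AddSubgroup Ω where
  carrier := {x | x ∈ L ∧ (r : WithTop ℚ) ≤ S.v x}
  zero_mem' := ⟨zero_mem L, by rw [S.v_zero]; exact le_top⟩
  add_mem' hx hy := ⟨add_mem hx.1 hy.1, S.le_v_add hx.2 hy.2⟩
  neg_mem' hx := ⟨neg_mem hx.1, by rw [S.v_neg]; exact hx.2⟩

variable {S} in
theorem mem_level {L : IntermediateField K Ω} {r : ℚ} {x : Ω} :
    x ∈ S.level L r ↔ x ∈ L ∧ (r : WithTop ℚ) ≤ S.v x := Iff.rfl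

theorem level_antitone (L : IntermediateField K Ω) : Antitone (S.level L) := fun _ _ h _ hx =>
  ⟨hx.1, le_trans (WithTop.coe_le_coe.2 h) hx.2⟩

theorem level_div_antitone (L : IntermediateField K Ω) (n : ℕ) :
    Antitone fun k : ℤ => S.level L (k / n) := fun _ _ h =>
  S.level_antitone L (div_le_div_of_nonneg_right (by exact_mod_cast h) (by positivity))

theorem level_top_inf (L : IntermediateField K Ω) {r s : ℚ} (h : s ≤ r) :
    S.level ⊤ r ⊓ S.level L s = S.level L r := by
  ext x
  simp only [AddSubgroup.mem_inf, mem_level]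
  exact ⟨fun hx => ⟨hx.2.1, hx.1.2⟩, fun hx => ⟨⟨mem_top, hx.2⟩, hx.1,
    le_trans (WithTop.coe_le_coe.2 h) hx.2⟩⟩

/-- Successive levels of a totally ramified extension have index the cardinality of the residue
field. -/
theorem relIndex_level_succ (O : Subring K) (hO : ∀ x : K, x ∈ O ↔ 0 ≤ S.v (algebraMap K Ω x))
    (P : Ideal O) (hP : ∀ x : O, x ∈ P ↔ 0 < S.v (algebraMap K Ω (x : K)))
    {L : IntermediateField K Ω} {n : ℕ} (hn : 0 < n) {ϖ : Ω} (hϖL : ϖ ∈ L)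
    (hϖ : S.v ϖ = ((1 / n : ℚ) : WithTop ℚ))
    (hres : ∀ y ∈ L, 0 ≤ S.v y → ∃ c : K, 0 ≤ S.v (algebraMap K Ω c) ∧
      ((1 / n : ℚ) : WithTop ℚ) ≤ S.v (y - algebraMap K Ω c)) (k : ℤ) :
    (S.level L ((k + 1 : ℤ) / n)).relIndex (S.level L (k / n)) = Nat.card (O ⧸ P) := by
  have hn' : (0 : ℚ) < n := by exact_mod_cast hn
  have hpow : S.v (ϖ ^ k) = ((k / n : ℚ) : WithTop ℚ) := by
    rw [S.v_zpow hϖ, mul_one_div]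
  have hpow' : S.v (ϖ ^ k)⁻¹ = ((-(k / n) : ℚ) : WithTop ℚ) := S.v_inv hpow
  have hpow0 : ϖ ^ k ≠ 0 := S.ne_zero_of_v hpow
  set J := S.level L ((k + 1 : ℤ) / n) with hJ
  have hsucc : (((k + 1 : ℤ) / n : ℚ) : WithTop ℚ) = ((1 / n : ℚ) : WithTop ℚ) + ((k / n : ℚ) : WithTop ℚ) := by
    rw [← WithTop.coe_add]
    push_cast
    congr 1
    ring
  let φ : O →+ Ω ⧸ J := (QuotientAddGroup.mk' J).comp
    ((AddMonoidHom.mulRight (ϖ ^ k)).comp ((algebraMap K Ω).comp O.subtype).toAddMonoidHom)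
  have hφ : ∀ x : O, φ x = QuotientAddGroup.mk (algebraMap K Ω x * ϖ ^ k) := fun _ => rfl
  have hker : φ.ker = P.toAddSubgroup := by
    ext x
    rw [AddMonoidHom.mem_ker, hφ, QuotientAddGroup.eq_zero_iff, Submodule.mem_toAddSubgroup, hP, hJ,
      mem_level, S.v_mul, hpow, hsucc, WithTop.add_le_add_iff_right WithTop.coe_ne_top]
    refine ⟨fun h => lt_of_lt_of_le (WithTop.coe_lt_coe.2 (by positivity)) h.2, fun h =>
      ⟨mul_mem (L.algebraMap_mem _) (zpow_mem hϖL k), ?_⟩⟩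
    rcases eq_or_ne (x : K) 0 with h0 | h0
    · rw [h0, map_zero, S.v_zero]
      exact le_top
    obtain ⟨m, hm⟩ := S.v_int _ h0
    rw [hm] at h ⊢
    have hm0 : 0 < m := by exact_mod_cast h
    refine WithTop.coe_le_coe.2 (le_trans ((div_le_one hn').2 (by exact_mod_cast hn)) ?_)
    exact_mod_cast hm0
  have hrange : φ.range = (S.level L (k / n)).map (QuotientAddGroup.mk' J) := by
    ext y
    constructor
    · rintro ⟨x, rfl⟩
      refine ⟨algebraMap K Ω x * ϖ ^ k, ⟨mul_mem (L.algebraMap_mem _) (zpow_mem hϖL k), ?_⟩, rfl⟩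
      rw [S.v_mul, hpow]
      exact le_add_of_nonneg_left ((hO _).1 x.2)
    · rintro ⟨x, ⟨hxL, hx⟩, rfl⟩
      obtain ⟨c, hc, hcx⟩ := hres (x * (ϖ ^ k)⁻¹) (mul_mem hxL (inv_mem (zpow_mem hϖL k))) (by
        rw [S.v_mul, hpow']
        calc (0 : WithTop ℚ) = ((k / n : ℚ) : WithTop ℚ) + ((-(k / n) : ℚ) : WithTop ℚ) := by
              rw [← WithTop.coe_add, add_neg_cancel]; rfl
          _ ≤ _ := add_le_add_left hx _)
      refine ⟨⟨c, (hO c).2 hc⟩, ?_⟩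
      rw [hφ]
      refine QuotientAddGroup.eq.2 ⟨add_mem (neg_mem (mul_mem (L.algebraMap_mem _) (zpow_mem hϖL k))) hxL, ?_⟩
      have : -(algebraMap K Ω c * ϖ ^ k) + x = (x * (ϖ ^ k)⁻¹ - algebraMap K Ω c) * ϖ ^ k := by
        rw [sub_mul, inv_mul_cancel_right₀ hpow0]
        ring
      rw [this, S.v_mul, hpow, hsucc]
      exact add_le_add_left hcx _
  have h1 := AddSubgroup.relIndex_ker (S.level L (k / n)) (QuotientAddGroup.mk' J)
  rw [QuotientAddGroup.ker_mk', ← hrange, ← AddSubgroup.index_ker, hker] at h1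
  rw [h1]
  rfl

theorem exists_v_eq_div_of_mem_adjoin {n : ℕ} {α : Ω} (hα : S.v α = ((1 / n : ℚ) : WithTop ℚ))
    (hint : IsIntegral K α) (hdeg : (minpoly K α).natDegree = n)
    {x : Ω} (hx : x ∈ K⟮α⟯) (hx0 : x ≠ 0) :
    ∃ k : ℤ, S.v x = ((k / n : ℚ) : WithTop ℚ) := by
  obtain ⟨h, hd, rfl⟩ := exists_aeval_eq_of_mem_adjoin hint hx
  have h0 : h ≠ 0 := by
    rintro rfl
    exact hx0 (map_zero _)
  obtain ⟨i, hi, k, -, hv, -⟩ := S.v_aeval_eq_min hα h0 (hdeg ▸ hd)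
  have hn : (n : ℚ) ≠ 0 := by
    have : n ≠ 0 := by omega
    exact_mod_cast this
  refine ⟨k * n + i, ?_⟩
  rw [hv]
  congr 1
  push_cast
  field_simp

theorem exists_residue_of_mem_adjoin {n : ℕ} {α : Ω} (hα : S.v α = ((1 / n : ℚ) : WithTop ℚ))
    (hint : IsIntegral K α) (hdeg : (minpoly K α).natDegree = n)
    {y : Ω} (hy : y ∈ K⟮α⟯) (hy0 : 0 ≤ S.v y) :
    ∃ c : K, 0 ≤ S.v (algebraMap K Ω c) ∧
      ((1 / n : ℚ) : WithTop ℚ) ≤ S.v (y - algebraMap K Ω c) := by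
  obtain ⟨h, hd, rfl⟩ := exists_aeval_eq_of_mem_adjoin hint hy
  rcases eq_or_ne h 0 with rfl | h0
  · refine ⟨0, ?_⟩
    simp [S.v_zero]
  obtain ⟨i, hi, k, -, hv, hmin⟩ := S.v_aeval_eq_min hα h0 (hdeg ▸ hd)
  rw [hv] at hy0
  have hn : (0 : ℚ) < n := by exact_mod_cast (by omega : 0 < n)
  have hcoeff : ∀ j, 0 ≤ S.v (algebraMap K Ω (h.coeff j)) := fun j => by
    rcases lt_or_ge j n with hj | hj
    · rcases eq_or_ne (h.coeff j) 0 with hc | hc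
      · rw [hc, map_zero, S.v_zero]
        exact le_top
      obtain ⟨m, hm⟩ := S.v_int _ hc
      have h1 := hy0.trans (hmin j)
      rw [hm] at h1 ⊢
      have h2 : (0 : ℚ) ≤ m + j / n := by exact_mod_cast h1
      have h3 : (j / n : ℚ) < 1 := (div_lt_one hn).2 (by exact_mod_cast hj)
      have h4 : (-1 : ℚ) < m := by linarith
      have h5 : -1 < m := by exact_mod_cast h4
      have h6 : 0 ≤ m := by omega
      exact_mod_cast h6
    · rw [coeff_eq_zero_of_natDegree_lt (by omega), map_zero, S.v_zero]
      exact le_top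
  refine ⟨h.coeff 0, hcoeff 0, ?_⟩
  have : aeval α h - algebraMap K Ω (h.coeff 0) = aeval α h.divX * α := by
    conv_lhs => rw [← divX_mul_X_add h]
    simp
  rw [this, S.v_mul, hα]
  refine le_add_of_nonneg_left (S.v_aeval_nonneg ?_ fun i => ?_)
  · rw [hα]
    exact_mod_cast (one_div_pos.2 hn).le
  · rw [coeff_divX]
    exact hcoeff _

/-- The number of residue classes of uniformizers of a totally ramified extension. -/
theorem ncard_mk_uniformizers {n : ℕ} {α : Ω} (hα : S.v α = ((1 / n : ℚ) : WithTop ℚ))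
    (hint : IsIntegral K α) (hdeg : (minpoly K α).natDegree = n)
    (hn : 0 < n) (O : Subring K)
    (hO : ∀ x : K, x ∈ O ↔ 0 ≤ S.v (algebraMap K Ω x))
    (P : Ideal O) (hP : ∀ x : O, x ∈ P ↔ 0 < S.v (algebraMap K Ω (x : K)))
    {q : ℕ} (hq : Nat.card (O ⧸ P) = q) (hq0 : q ≠ 0) {c : ℤ} (hc : 2 ≤ c) :
    (((QuotientAddGroup.mk : Ω → Ω ⧸ S.level (⊤ : IntermediateField K Ω) (c / n)) ''
      {β | β ∈ K⟮α⟯ ∧ S.v β = ((1 / n : ℚ) : WithTop ℚ)}).ncard : ℚ) =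
        (q : ℚ) ^ (c - 1) - (q : ℚ) ^ (c - 2) := by
  have hn' : (0 : ℚ) < n := by exact_mod_cast hn
  have h := AddSubgroup.ncard_mk_image_chain_diff (S.level_div_antitone K⟮α⟯ n)
    (fun k => (S.relIndex_level_succ O hO P hP hn (mem_adjoin_simple_self K α) hα
      (fun _ => S.exists_residue_of_mem_adjoin hα hint hdeg) k).trans hq) hq0
    (H := S.level ⊤ (c / n)) (a := 1) (b := c) (by omega)
    (S.level_top_inf _ (div_le_div_of_nonneg_right (by exact_mod_cast (by omega : 1 ≤ c)) hn'.le))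
  rw [sub_sub, show (1 : ℤ) + 1 = 2 from rfl] at h
  rw [← h]
  congr 3
  ext x
  simp only [Set.mem_sdiff, SetLike.mem_coe, mem_level, Set.mem_ofPred_eq]
  constructor
  · rintro ⟨hx, hv⟩
    refine ⟨⟨hx, ?_⟩, fun h => ?_⟩
    · rw [hv, Int.cast_one]
    · have h2 := h.2
      rw [hv] at h2
      have h3 := (div_le_div_iff_of_pos_right hn').1 (WithTop.coe_le_coe.1 h2)
      norm_num at h3
  · rintro ⟨⟨hx, hv⟩, hnot⟩
    refine ⟨hx, ?_⟩
    rcases eq_or_ne x 0 with rfl | hx0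
    · exact absurd ⟨hx, by rw [S.v_zero]; exact le_top⟩ hnot
    obtain ⟨k, hk⟩ := S.exists_v_eq_div_of_mem_adjoin hα hint hdeg hx hx0
    have hnot' : ¬ (((2 : ℤ) / n : ℚ) : WithTop ℚ) ≤ S.v x := fun h => hnot ⟨hx, h⟩
    rw [hk] at hv hnot' ⊢
    rw [WithTop.coe_le_coe, div_le_div_iff_of_pos_right hn'] at hv hnot'
    have h1 : (1 : ℤ) ≤ k := by exact_mod_cast hv
    have h2 : ¬ (2 : ℤ) ≤ k := fun h => hnot' (by exact_mod_cast h)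
    have h3 : k = 1 := by omega
    rw [h3, Int.cast_one]

theorem relIndex_level_bot_succ (O : Subring K)
    (hO : ∀ x : K, x ∈ O ↔ 0 ≤ S.v (algebraMap K Ω x))
    (P : Ideal O) (hP : ∀ x : O, x ∈ P ↔ 0 < S.v (algebraMap K Ω (x : K)))
    {q : ℕ} (hq : Nat.card (O ⧸ P) = q) (k : ℤ) :
    (S.level (⊥ : IntermediateField K Ω) ((k + 1 : ℤ) : ℚ)).relIndex (S.level ⊥ (k : ℚ)) = q := by
  have h := S.relIndex_level_succ O hO P hP (L := ⊥) one_pos (IntermediateField.algebraMap_mem _ S.unif)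
    (by rw [S.v_unif]; norm_num) (fun y hy hy0 => by
      obtain ⟨c, rfl⟩ := mem_bot.1 hy
      exact ⟨c, hy0, by rw [sub_self, S.v_zero]; exact le_top⟩) k
  simpa only [Nat.cast_one, div_one, hq] using h

theorem ncard_mk_level_bot (O : Subring K)
    (hO : ∀ x : K, x ∈ O ↔ 0 ≤ S.v (algebraMap K Ω x))
    (P : Ideal O) (hP : ∀ x : O, x ∈ P ↔ 0 < S.v (algebraMap K Ω (x : K)))
    {q : ℕ} (hq : Nat.card (O ⧸ P) = q) {l m : ℤ} (hl : l ≤ m) :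
    (((QuotientAddGroup.mk : Ω → Ω ⧸ S.level (⊤ : IntermediateField K Ω) m) ''
      (S.level ⊥ (l : ℚ))).ncard : ℚ) = (q : ℚ) ^ (m - l) := by
  have h := AddSubgroup.ncard_mk_image_chain (I := fun k : ℤ => S.level (⊥ : IntermediateField K Ω) k)
    (fun _ _ h => S.level_antitone _ (by exact_mod_cast h)) (S.relIndex_level_bot_succ O hO P hP hq) hl
    (S.level_top_inf _ (by exact_mod_cast hl))
  rw [h, Nat.cast_pow, ← zpow_natCast, Int.toNat_of_nonneg (by omega)]

theorem ncard_mk_sphere_bot (O : Subring K)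
    (hO : ∀ x : K, x ∈ O ↔ 0 ≤ S.v (algebraMap K Ω x))
    (P : Ideal O) (hP : ∀ x : O, x ∈ P ↔ 0 < S.v (algebraMap K Ω (x : K)))
    {q : ℕ} (hq : Nat.card (O ⧸ P) = q) (hq0 : q ≠ 0) {l m : ℤ} (hl : l < m) :
    (((QuotientAddGroup.mk : Ω → Ω ⧸ S.level (⊤ : IntermediateField K Ω) m) ''
      {x | x ∈ (⊥ : IntermediateField K Ω) ∧ S.v x = ((l : ℚ) : WithTop ℚ)}).ncard : ℚ) =
        (q : ℚ) ^ (m - l) - (q : ℚ) ^ (m - l - 1) := by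
  have h := AddSubgroup.ncard_mk_image_chain_diff (I := fun k : ℤ => S.level (⊥ : IntermediateField K Ω) k)
    (fun _ _ h => S.level_antitone _ (by exact_mod_cast h)) (S.relIndex_level_bot_succ O hO P hP hq)
    hq0 hl (S.level_top_inf _ (by exact_mod_cast hl.le))
  rw [← h]
  congr 3
  ext x
  simp only [Set.mem_sdiff, SetLike.mem_coe, mem_level, Set.mem_ofPred_eq]
  refine ⟨fun ⟨hx, hv⟩ => ⟨⟨hx, hv.ge⟩, fun h => ?_⟩, fun ⟨⟨hx, hv⟩, hnot⟩ => ⟨hx, ?_⟩⟩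
  · have h2 := h.2
    rw [hv] at h2
    have h3 : l + 1 ≤ l := by exact_mod_cast h2
    omega
  · obtain ⟨y, rfl⟩ := mem_bot.1 hx
    rcases eq_or_ne y 0 with rfl | hy
    · exact absurd ⟨hx, by rw [map_zero, S.v_zero]; exact le_top⟩ hnot
    obtain ⟨k, hk⟩ := S.v_int y hy
    have hnot' : ¬ (((l + 1 : ℤ) : ℚ) : WithTop ℚ) ≤ S.v (algebraMap K Ω y) := fun h => hnot ⟨hx, h⟩
    change _ ≤ S.v (algebraMap K Ω y) at hv
    change S.v (algebraMap K Ω y) = _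
    rw [hk] at hv hnot' ⊢
    have h1 : l ≤ k := by exact_mod_cast hv
    have h2 : ¬ l + 1 ≤ k := fun h => hnot' (by exact_mod_cast h)
    have h3 : k = l := by omega
    rw [h3]

end PadicSetup

theorem Set.ncard_iUnion_of_fibers {ι γ : Type*} {T : ι → Set γ}
    (hdisj : ∀ i j x, x ∈ T i → x ∈ T j → i = j) {r : ℚ} (hr : 0 < r)
    (h : ∀ i, ((T i).ncard : ℚ) = r) : ((⋃ i, T i).ncard : ℚ) = Nat.card ι * r := by
  rcases isEmpty_or_nonempty ι with hι | ⟨⟨i₀⟩⟩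
  · simp
  set k := (T i₀).ncard with hk
  have hkr : (k : ℚ) = r := h i₀
  have hTk : ∀ i, Nat.card (T i) = k := fun i => by
    have : ((T i).ncard : ℚ) = k := by rw [h, hkr]
    exact_mod_cast this
  have hk0 : k ≠ 0 := by
    rintro h0
    rw [h0, Nat.cast_zero] at hkr
    exact hr.ne hkr
  have hequiv : ∀ i, Nonempty (T i ≃ Fin k) := fun i => by
    have : Finite (T i) := Nat.finite_of_card_ne_zero (by rw [hTk]; exact hk0)
    exact ⟨Finite.equivFinOfCardEq (hTk i)⟩
  have e : (⋃ i, T i) ≃ ι × Fin k :=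
    (Set.unionEqSigmaOfDisjoint fun i j hij => Set.disjoint_left.2 fun x hi hj =>
      hij (hdisj i j x hi hj)).trans
      ((Equiv.sigmaCongrRight fun i => (hequiv i).some).trans (Equiv.sigmaEquivProd _ _))
  rw [← Nat.card_coe_set_eq, Nat.card_congr e, Nat.card_prod, Nat.card_fin, Nat.cast_mul, hkr]

namespace PadicSetup

open IntermediateField

variable (S : PadicSetup p K Ω)

/-- The roots of Eisenstein polynomials of degree `n` whose derivative has valuation `δ`. -/
def eisensteinRoots (n : ℕ) (δ : ℚ) : Set Ω :=
  {α | ∃ f : K[X], S.IsEisensteinOfDegree f n ∧ aeval α f = 0 ∧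
    S.v (aeval α (derivative f)) = (δ : WithTop ℚ)}

/-- The totally ramified extensions of degree `n` with different of valuation `δ`. -/
def ramifiedFields (n : ℕ) (δ : ℚ) : Set (IntermediateField K Ω) :=
  {L | ∃ f : K[X], S.IsEisensteinOfDegree f n ∧ ∃ α : Ω, aeval α f = 0 ∧ L = K⟮α⟯ ∧
    S.v (aeval α (derivative f)) = (δ : WithTop ℚ)}

theorem mk_eq_mk_iff {r : ℚ} {x y : Ω} :
    (QuotientAddGroup.mk x : Ω ⧸ S.level (⊤ : IntermediateField K Ω) r) = QuotientAddGroup.mk y ↔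
      (r : WithTop ℚ) ≤ S.v (x - y) := by
  rw [QuotientAddGroup.eq, mem_level, and_iff_right mem_top, neg_add_eq_sub, S.v_sub_comm]

theorem ncard_mk_eisensteinRoots_fields [Algebra.IsAlgebraic ℚ_[p] Ω] [IsAlgClosed Ω]
    [Algebra.IsAlgebraic K Ω] (O : Subring K)
    (hO : ∀ x : K, x ∈ O ↔ 0 ≤ S.v (algebraMap K Ω x))
    (P : Ideal O) (hP : ∀ x : O, x ∈ P ↔ 0 < S.v (algebraMap K Ω (x : K)))
    {q : ℕ} (hq : Nat.card (O ⧸ P) = q) (hq2 : 2 ≤ q) {n : ℕ} (hn : 0 < n) {c : ℤ} (hc : 2 ≤ c)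
    {δ : ℚ} (hδ : δ < c / n) :
    (((QuotientAddGroup.mk : Ω → Ω ⧸ S.level (⊤ : IntermediateField K Ω) (c / n)) ''
      S.eisensteinRoots n δ).ncard : ℚ) =
        Nat.card (S.ramifiedFields n δ) * ((q : ℚ) ^ (c - 1) - (q : ℚ) ^ (c - 2)) := by
  classical
  have hunif : ∀ L ∈ S.ramifiedFields n δ, ∀ β ∈ L, S.v β = ((1 / n : ℚ) : WithTop ℚ) →
      K⟮β⟯ = L ∧ S.IsEisensteinOfDegree (minpoly K β) n ∧
        S.v (aeval β (derivative (minpoly K β))) = (δ : WithTop ℚ) := by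
    rintro L ⟨f, hf, α, hα, rfl, hδα⟩ β hβ hvβ
    have hvα := S.v_root_of_isEisenstein hn hf hα
    have hint : IsIntegral K α := ⟨f, hf.1, hα⟩
    obtain rfl := S.minpoly_eq_of_monic hvα hf.1 hf.2.1 hα
    obtain ⟨h1, h2⟩ := S.isEisenstein_minpoly_of_mem_adjoin hn hint hf.2.1 hβ hvβ
    refine ⟨h1, h2, le_antisymm ?_ ?_⟩
    · rw [← hδα]
      exact S.v_derivative_minpoly_le O hO hn hvβ hvα h2 hf (h1 ▸ mem_adjoin_simple_self K α)
    · rw [← hδα]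
      exact S.v_derivative_minpoly_le O hO hn hvα hvβ hf h2 hβ
  let T : S.ramifiedFields n δ → Set (Ω ⧸ S.level (⊤ : IntermediateField K Ω) (c / n)) := fun L =>
    QuotientAddGroup.mk '' {β | β ∈ (L : IntermediateField K Ω) ∧ S.v β = ((1 / n : ℚ) : WithTop ℚ)}
  have hY : (QuotientAddGroup.mk '' S.eisensteinRoots n δ) = ⋃ L, T L := by
    rw [← Set.image_iUnion]
    congr 1
    ext β
    simp only [Set.mem_iUnion, Subtype.exists]
    constructor
    · rintro ⟨f, hf, hβ, hδβ⟩
      exact ⟨K⟮β⟯, ⟨f, hf, β, hβ, rfl, hδβ⟩, mem_adjoin_simple_self K β,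
        S.v_root_of_isEisenstein hn hf hβ⟩
    · rintro ⟨L, hL, hβ, hvβ⟩
      obtain ⟨-, h1, h2⟩ := hunif L hL β hβ hvβ
      exact ⟨_, h1, minpoly.aeval _ _, h2⟩
  rw [hY]
  have hq1 : (1 : ℚ) < q := by exact_mod_cast hq2
  refine Set.ncard_iUnion_of_fibers ?_ (sub_pos.2 (zpow_lt_zpow_right₀ hq1 (by omega))) ?_
  · rintro ⟨L, hL⟩ ⟨L', hL'⟩ _ ⟨β, ⟨hβ, hvβ⟩, rfl⟩ ⟨β', ⟨hβ', hvβ'⟩, hββ'⟩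
    obtain ⟨h1, h2, h3⟩ := hunif L hL β hβ hvβ
    obtain ⟨h1', h2', h3'⟩ := hunif L' hL' β' hβ' hvβ'
    have hclose := S.mk_eq_mk_iff.1 hββ'.symm
    have hmem : β ∈ K⟮β'⟯ := S.mem_adjoin_of_krasner fun β'' hβ'' hne =>
      calc S.v (β - β'') ≤ (δ : WithTop ℚ) := h3 ▸ S.v_sub_root_le_v_derivative hn h2
              (minpoly.aeval _ _) hβ'' hne
        _ < ((c / n : ℚ) : WithTop ℚ) := WithTop.coe_lt_coe.2 hδ
        _ ≤ _ := hclose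
    have h4 := (S.isEisenstein_minpoly_of_mem_adjoin hn
      (minpoly.ne_zero_iff.1 h2'.1.ne_zero) h2'.2.1 hmem hvβ).1
    exact Subtype.ext (h1.symm.trans (h4.trans h1'))
  · rintro ⟨L, f, hf, α, hα, rfl, hδα⟩
    have hvα := S.v_root_of_isEisenstein hn hf hα
    obtain rfl := S.minpoly_eq_of_monic hvα hf.1 hf.2.1 hα
    exact S.ncard_mk_uniformizers hvα ⟨_, hf.1, hα⟩ hf.2.1 hn O hO P hP hq (by omega) hc

end PadicSetup

theorem Polynomial.exists_monic_coeff_eq {R : Type*} [CommRing R] [Nontrivial R] {n : ℕ}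
    (a : Fin n → R) :
    ∃ f : R[X], f.Monic ∧ f.natDegree = n ∧ ∀ i : Fin n, f.coeff i = a i := by
  classical
  refine ⟨X ^ n + ofFn n a, monic_X_pow_add (ofFn_degree_lt a), ?_, fun i => ?_⟩
  · rw [natDegree_add_eq_left_of_degree_lt (by rw [degree_X_pow]; exact ofFn_degree_lt a),
      natDegree_X_pow]
  · rw [coeff_add, coeff_X_pow, if_neg i.2.ne, zero_add, ofFn_coeff_eq_val_of_lt a i.2]

namespace PadicSetup

open IntermediateField

variable (S : PadicSetup p K Ω)

/-- Counting residue classes of roots of Eisenstein polynomials through the residue classes of the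
coefficients of these polynomials. -/
theorem ncard_mk_eisensteinRoots_coeff [IsAlgClosed Ω] {n : ℕ} (hn : 0 < n) {δ γ : ℚ} {m : ℤ}
    (hδγ : δ < γ) (hm : γ + δ = m) {C : ℕ → Set Ω} (hC : ∀ i, ∀ x ∈ C i, ∃ y : K, algebraMap K Ω y = x)
    (hC₁ : ∀ f : K[X], f.Monic → f.natDegree = n → (∀ i < n, algebraMap K Ω (f.coeff i) ∈ C i) →
      S.IsEisensteinOfDegree f n ∧
        ∀ α, aeval α f = 0 → S.v (aeval α (derivative f)) = (δ : WithTop ℚ))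
    (hC₂ : ∀ f : K[X], S.IsEisensteinOfDegree f n → ∀ α, aeval α f = 0 →
      S.v (aeval α (derivative f)) = (δ : WithTop ℚ) → ∀ i < n, algebraMap K Ω (f.coeff i) ∈ C i) :
    (((QuotientAddGroup.mk : Ω → Ω ⧸ S.level (⊤ : IntermediateField K Ω) γ) ''
      S.eisensteinRoots n δ).ncard : ℚ) =
        (∏ i ∈ Finset.range n, (((QuotientAddGroup.mk : Ω → Ω ⧸ S.level (⊤ : IntermediateField K Ω) m) ''
          C i).ncard : ℚ)) * n := by
  classical
  have hn' : (0 : ℚ) < n := by exact_mod_cast hn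
  let D : Fin n → Type _ := fun i =>
    ((QuotientAddGroup.mk : Ω → Ω ⧸ S.level (⊤ : IntermediateField K Ω) m) '' C i : Set _)
  have hrep : ∀ e : (∀ i, D i), ∃ f : K[X], f.Monic ∧ f.natDegree = n ∧
      ∀ i : Fin n, algebraMap K Ω (f.coeff i) ∈ C i ∧
        QuotientAddGroup.mk (algebraMap K Ω (f.coeff i)) = (e i).1 := fun e => by
    have : ∀ i : Fin n, ∃ y : K, algebraMap K Ω y ∈ C i ∧ QuotientAddGroup.mk (algebraMap K Ω y) = (e i).1 :=
      fun i : Fin n => by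
        obtain ⟨x, hx, hxe⟩ := (e i).2
        obtain ⟨y, rfl⟩ := hC _ x hx
        exact ⟨y, hx, hxe⟩
    choose a ha using this
    obtain ⟨f, hf, hd, hfa⟩ := exists_monic_coeff_eq a
    exact ⟨f, hf, hd, fun i => hfa i ▸ ha i⟩
  choose F hmon hdeg hF using hrep
  have hFE : ∀ e, S.IsEisensteinOfDegree (F e) n ∧
      ∀ α, aeval α (F e) = 0 → S.v (aeval α (derivative (F e))) = (δ : WithTop ℚ) := fun e =>
    hC₁ _ (hmon e) (hdeg e) fun i hi => (hF e ⟨i, hi⟩).1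
  have hsublt : ∀ f g : K[X], f.Monic → g.Monic → f.natDegree = n → g.natDegree = n → f - g ≠ 0 →
      (f - g).natDegree < n := fun f g hf hg hfn hgn hfg => by
    rw [← hfn]
    refine natDegree_lt_natDegree hfg (degree_sub_lt_left ?_ hf.ne_zero ?_)
    · rw [degree_eq_natDegree hf.ne_zero, degree_eq_natDegree hg.ne_zero, hfn, hgn]
    · rw [hf.leadingCoeff, hg.leadingCoeff]
  let T : (∀ i, D i) → Set (Ω ⧸ S.level (⊤ : IntermediateField K Ω) γ) := fun e =>
    QuotientAddGroup.mk '' {α | aeval α (F e) = 0}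
  have hcard : (Nat.card (∀ i, D i) : ℚ) =
      ∏ i ∈ Finset.range n, (((QuotientAddGroup.mk : Ω → Ω ⧸ S.level (⊤ : IntermediateField K Ω) m) ''
          C i).ncard : ℚ) := by
    rw [Nat.card_pi, Nat.cast_prod, Finset.prod_range]
    rfl
  have hY : (QuotientAddGroup.mk '' S.eisensteinRoots n δ) = ⋃ e, T e := by
    ext x
    rw [Set.mem_iUnion]
    constructor
    · rintro ⟨α, ⟨f, hf, hα, hδα⟩, rfl⟩
      have hfC := hC₂ f hf α hα hδα
      let e : ∀ i, D i := fun i => ⟨_, _, hfC i i.2, rfl⟩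
      have hdiff : ((m : ℚ) : WithTop ℚ) ≤ S.v (aeval α (F e)) := by
        have h1 : aeval α (F e) = aeval α (F e - f) := by rw [map_sub, hα, sub_zero]
        rw [h1]
        rcases eq_or_ne (F e - f) 0 with h0 | h0
        · rw [h0, map_zero, S.v_zero]
          exact le_top
        have hlt := hsublt _ _ (hmon e) hf.1 (hdeg e) hf.2.1 h0
        rw [aeval_eq_sum_range]
        refine S.le_v_sum fun i hi => ?_
        have hin : i < n := by
          rw [Finset.mem_range] at hi
          omega
        rw [Algebra.smul_def, S.v_mul, coeff_sub, map_sub,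
          S.v_pow (S.v_root_of_isEisenstein hn hf hα)]
        refine le_trans (S.mk_eq_mk_iff.1 (hF e ⟨i, hin⟩).2) (le_add_of_nonneg_right ?_)
        exact_mod_cast (by positivity : (0 : ℚ) ≤ i * (1 / n))
      obtain ⟨β, hβ, hαβ⟩ := S.exists_root_near hn (hFE e).1 α
      refine ⟨e, β, hβ, ?_⟩
      rw [S.mk_eq_mk_iff, S.v_sub_comm]
      have h2 := hdiff.trans hαβ
      rw [(hFE e).2 β hβ, ← hm, WithTop.coe_add,
        WithTop.add_le_add_iff_right WithTop.coe_ne_top] at h2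
      exact h2
    · rintro ⟨e, α, hα, rfl⟩
      exact ⟨α, ⟨F e, (hFE e).1, hα, (hFE e).2 α hα⟩, rfl⟩
  rw [hY, ← hcard]
  refine Set.ncard_iUnion_of_fibers ?_ hn' fun e => ?_
  · rintro e e' _ ⟨α, hα, rfl⟩ ⟨β, hβ, hαβ⟩
    rw [S.mk_eq_mk_iff] at hαβ
    have h1 := S.v_sub_add_v_derivative_le hn (hFE e).1 hα (x := β) (by
      rw [(hFE e).2 α hα]
      exact (WithTop.coe_le_coe.2 hδγ.le).trans hαβ)
    rw [(hFE e).2 α hα] at h1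
    have h2 : ((m : ℚ) : WithTop ℚ) ≤ S.v (aeval β (F e - F e')) := by
      rw [map_sub, show aeval β (F e') = 0 from hβ, sub_zero, ← hm, WithTop.coe_add]
      exact (add_le_add_left hαβ _).trans h1
    funext i
    refine Subtype.ext ?_
    rw [← (hF e i).2, ← (hF e' i).2, S.mk_eq_mk_iff, ← map_sub, ← coeff_sub]
    rcases eq_or_ne (F e - F e') 0 with h0 | h0
    · rw [h0, coeff_zero, map_zero, S.v_zero]
      exact le_top
    obtain ⟨j, -, k, -, hv, hmin⟩ := S.v_aeval_eq_min (S.v_root_of_isEisenstein hn (hFE e').1 hβ) h0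
      (hsublt _ _ (hmon e) (hmon e') (hdeg e) (hdeg e') h0)
    rw [hv] at h2
    have h3 := h2.trans (hmin i)
    have hi : ((i : ℕ) / n : ℚ) < 1 := (div_lt_one hn').2 (by exact_mod_cast i.2)
    refine S.le_v_algebraMap_of_lt (r := m - (i : ℕ) / n) ?_ (by linarith)
    rw [← WithTop.add_le_add_iff_right (WithTop.coe_ne_top (a := ((i : ℕ) / n : ℚ))), ← WithTop.coe_add,
      sub_add_cancel]
    exact h3
  · have hsep := S.separable_of_isEisenstein hn (hFE e).1
    have hroots : {α : Ω | aeval α (F e) = 0} = (((F e).aroots Ω).toFinset : Set Ω) := by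
      ext α
      exact (mem_rootFinset_iff (hmon e)).symm
    have hinj : Set.InjOn (QuotientAddGroup.mk : Ω → Ω ⧸ S.level (⊤ : IntermediateField K Ω) γ)
        {α | aeval α (F e) = 0} := by
      intro α hα β hβ hαβ
      by_contra hne
      have h1 := (S.mk_eq_mk_iff.1 hαβ).trans
        (S.v_sub_root_le_v_derivative hn (hFE e).1 hα hβ (Ne.symm hne))
      rw [(hFE e).2 α hα, WithTop.coe_le_coe] at h1
      exact absurd hδγ (not_lt.2 h1)
    rw [hinj.ncard_image, hroots, Set.ncard_coe_finset, card_rootFinset hsep, hdeg]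

/-- The possible `i`-th coefficients of the Eisenstein polynomials with a given different. -/
def coeffClass (b₀ : ℕ) (l : ℕ → ℤ) (i : ℕ) : Set Ω :=
  {x | x ∈ (⊥ : IntermediateField K Ω) ∧
    if i = 0 then S.v x = 1 else if i = b₀ then S.v x = ((l i : ℚ) : WithTop ℚ)
      else ((l i : ℚ) : WithTop ℚ) ≤ S.v x}

theorem forall_mem_coeffClass_iff {b₀ n : ℕ} (hn : 0 < n) (hb : b₀ < n) {l : ℕ → ℤ}
    (hl : ∀ i, 1 ≤ l i) {f : K[X]} (hf : f.Monic) (hd : f.natDegree = n) :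
    (∀ i < n, algebraMap K Ω (f.coeff i) ∈ S.coeffClass b₀ l i) ↔
      S.IsEisensteinOfDegree f n ∧
      (∀ i, 1 ≤ i → i < n → ((l i : ℚ) : WithTop ℚ) ≤ S.v (algebraMap K Ω (f.coeff i))) ∧
      (b₀ ≠ 0 → S.v (algebraMap K Ω (f.coeff b₀)) = ((l b₀ : ℚ) : WithTop ℚ)) := by
  constructor
  · intro h
    have h0 : S.v (algebraMap K Ω (f.coeff 0)) = 1 := by simpa using (h 0 hn).2
    have h1 : ∀ i, 1 ≤ i → i < n → ((l i : ℚ) : WithTop ℚ) ≤ S.v (algebraMap K Ω (f.coeff i)) := by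
      intro i hi hin
      have h2 := (h i hin).2
      rw [if_neg (by omega)] at h2
      split_ifs at h2
      · exact h2.ge
      · exact h2
    refine ⟨⟨hf, hd, fun i hi => ?_, h0⟩, h1, fun hb0 => ?_⟩
    · rcases Nat.eq_zero_or_pos i with rfl | hi0
      · exact h0.ge
      · exact le_trans (by exact_mod_cast hl i) (h1 i hi0 hi)
    · have h2 := (h b₀ hb).2
      rwa [if_neg hb0, if_pos rfl] at h2
  · rintro ⟨hE, h1, h2⟩ i hi
    refine ⟨IntermediateField.algebraMap_mem _ _, ?_⟩
    split_ifs with hi0 hib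
    · rw [hi0]
      exact hE.2.2.2
    · subst hib
      exact h2 hi0
    · exact h1 i (by omega) hi

theorem prod_ncard_mk_coeffClass (O : Subring K) (hO : ∀ x : K, x ∈ O ↔ 0 ≤ S.v (algebraMap K Ω x))
    (P : Ideal O) (hP : ∀ x : O, x ∈ P ↔ 0 < S.v (algebraMap K Ω (x : K)))
    {q : ℕ} (hq : Nat.card (O ⧸ P) = q) (hq0 : q ≠ 0) {n b₀ : ℕ} (hn : 0 < n) (hb : b₀ < n)
    {l : ℕ → ℤ} {m : ℤ} (hm : 1 < m) (hl : ∀ i, 1 ≤ i → i < n → l i < m) :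
    ∏ i ∈ Finset.range n, (((QuotientAddGroup.mk : Ω → Ω ⧸ S.level (⊤ : IntermediateField K Ω) m) ''
        S.coeffClass b₀ l i).ncard : ℚ) =
      ((q : ℚ) - 1) * (q : ℚ) ^ (n * m - 2 - ∑ i ∈ Finset.Icc 1 (n - 1), l i) *
        (if b₀ = 0 then 1 else 1 - (q : ℚ)⁻¹) := by
  have hq0' : (q : ℚ) ≠ 0 := by exact_mod_cast hq0
  have hIco : Finset.Ico 1 n = Finset.Icc 1 (n - 1) := by
    ext i
    simp only [Finset.mem_Ico, Finset.mem_Icc]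
    omega
  have hzero : (((QuotientAddGroup.mk : Ω → Ω ⧸ S.level (⊤ : IntermediateField K Ω) m) ''
        S.coeffClass b₀ l 0).ncard : ℚ) = ((q : ℚ) - 1) * (q : ℚ) ^ (m - 2) := by
    have h := S.ncard_mk_sphere_bot O hO P hP hq hq0 hm
    have hset : S.coeffClass b₀ l 0 =
        {x | x ∈ (⊥ : IntermediateField K Ω) ∧ S.v x = (((1 : ℤ) : ℚ) : WithTop ℚ)} := by
      ext x
      simp [coeffClass]
    rw [hset, h, show m - 1 - 1 = m - 2 by ring, show m - 1 = 1 + (m - 2) by ring,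
      zpow_add₀ hq0', zpow_one]
    ring
  have hpos : ∀ i ∈ Finset.Icc 1 (n - 1),
      (((QuotientAddGroup.mk : Ω → Ω ⧸ S.level (⊤ : IntermediateField K Ω) m) ''
        S.coeffClass b₀ l i).ncard : ℚ) =
        (q : ℚ) ^ (m - l i) * (if i = b₀ then 1 - (q : ℚ)⁻¹ else 1) := by
    intro i hi
    rw [Finset.mem_Icc] at hi
    have hi0 : i ≠ 0 := by omega
    have hli := hl i hi.1 (by omega)
    split_ifs with hib
    · have hset : S.coeffClass b₀ l i =
          {x | x ∈ (⊥ : IntermediateField K Ω) ∧ S.v x = ((l i : ℚ) : WithTop ℚ)} := by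
        subst hib
        ext x
        simp [coeffClass, hi0]
      rw [hset, S.ncard_mk_sphere_bot O hO P hP hq hq0 hli, zpow_sub_one₀ hq0']
      ring
    · have hset : S.coeffClass b₀ l i = S.level ⊥ (l i : ℚ) := by
        ext x
        simp [coeffClass, hi0, hib, mem_level]
      rw [hset, S.ncard_mk_level_bot O hO P hP hq hli.le, mul_one]
  have hsum : ∀ s : Finset ℕ, ∏ i ∈ s, (q : ℚ) ^ (m - l i) = (q : ℚ) ^ (∑ i ∈ s, (m - l i)) :=
    fun s => by
      classical
      induction s using Finset.induction_on with
      | empty => simp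
      | insert a s ha ih => rw [Finset.prod_insert ha, Finset.sum_insert ha, ih, zpow_add₀ hq0']
  have hite : (if b₀ ∈ Finset.Icc 1 (n - 1) then 1 - (q : ℚ)⁻¹ else 1) =
      if b₀ = 0 then 1 else 1 - (q : ℚ)⁻¹ := by
    rcases eq_or_ne b₀ 0 with h | h
    · simp [h]
    · rw [if_pos (Finset.mem_Icc.2 (by omega)), if_neg h]
  have hexp : (n * m - 2 - ∑ i ∈ Finset.Icc 1 (n - 1), l i : ℤ) =
      (m - 2) + ∑ i ∈ Finset.Icc 1 (n - 1), (m - l i) := by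
    rw [Finset.sum_sub_distrib, Finset.sum_const, Nat.card_Icc, nsmul_eq_mul, Nat.add_sub_cancel,
      Nat.cast_sub (by omega : 1 ≤ n)]
    push_cast
    ring
  rw [Finset.range_eq_Ico, Finset.prod_eq_prod_Ico_succ_bot hn, hIco, hzero, Finset.prod_congr rfl hpos,
    Finset.prod_mul_distrib, hsum, Finset.prod_ite_eq', hite, hexp, zpow_add₀ hq0']
  ring

end PadicSetup

/-- **Krasner's mass formula.** Let `q` be the cardinality of the residue
field of `K`, and let `n`, `J₀ = a₀ n + b₀` (with `0 ≤ b₀ < n`) satisfy Ore's conditions.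
With `l(i)` as in Ore's lemma, the number of totally ramified extensions `L/K` of degree
`n` inside a fixed algebraic closure `Ω` with `v_P(disc(L/K)) = n + J₀ - 1`
(such `L` being exactly the fields `K(α)` for `α` a root of an Eisenstein polynomial `f`
of degree `n` with `v_α(f'(α)) = n + J₀ - 1`) equals
`n·q^(n+J₀-1-Σ l(i))` if `b₀ = 0`, and `n·(q-1)·q^(n+J₀-1-Σ l(i)-1)` if `b₀ > 0`. -/
theorem krasner_mass_formula
    [FiniteDimensional ℚ_[p] K] [IsAlgClosed Ω] [Algebra.IsAlgebraic K Ω]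
    (S : PadicSetup p K Ω)
    (O : Subring K) (hO : ∀ x : K, x ∈ O ↔ 0 ≤ S.v (algebraMap K Ω x))
    (P : Ideal O) (hP : ∀ x : O, x ∈ P ↔ 0 < S.v (algebraMap K Ω (x : K)))
    (q : ℕ) (hq : Nat.card (O ⧸ P) = q)
    (w : ℕ → ℤ) (hw : ∀ m : ℕ, 0 < m → ((w m : ℚ) : WithTop ℚ) = S.v (algebraMap K Ω (m : K)))
    (n J₀ a₀ b₀ : ℕ) (hn : 0 < n) (hJ : J₀ = a₀ * n + b₀) (hb : b₀ < n)
    (hOre : min (((n : ℚ) : WithTop ℚ) * S.v (algebraMap K Ω (b₀ : K)))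
          (((n : ℚ) : WithTop ℚ) * S.v (algebraMap K Ω (n : K)))
        ≤ ((J₀ : ℚ) : WithTop ℚ)
      ∧ ((J₀ : ℚ) : WithTop ℚ) ≤ ((n : ℚ) : WithTop ℚ) * S.v (algebraMap K Ω (n : K)))
    (l : ℕ → ℤ)
    (hl : ∀ i, l i = if i < b₀ then max (2 + (a₀ : ℤ) - w i) 1 else max (1 + (a₀ : ℤ) - w i) 1) :
    (Nat.card {L : IntermediateField K Ω // ∃ f : K[X],
        S.IsEisensteinOfDegree f n ∧ ∃ α : Ω, aeval α f = 0 ∧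
          L = IntermediateField.adjoin K {α} ∧
          ((n : ℚ) : WithTop ℚ) * S.v (aeval α (derivative f)) =
            ((((n : ℤ) + (J₀ : ℤ) - 1 : ℤ) : ℚ) : WithTop ℚ)} : ℚ) =
      if b₀ = 0 then
        (n : ℚ) * (q : ℚ) ^ (((n : ℤ) + (J₀ : ℤ) - 1 - ∑ i ∈ Finset.Icc 1 (n - 1), l i) : ℤ)
      else
        (n : ℚ) * ((q : ℚ) - 1) *
          (q : ℚ) ^ (((n : ℤ) + (J₀ : ℤ) - 1 - (∑ i ∈ Finset.Icc 1 (n - 1), l i) - 1) : ℤ) := by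
  have : Algebra.IsAlgebraic ℚ_[p] Ω := Algebra.IsAlgebraic.trans ℚ_[p] K Ω
  have hq2 : 2 ≤ q := hq ▸ S.two_le_card_residue O hO P hP
  obtain ⟨h1, h2, h3⟩ := S.ore_conditions_int hw hn hJ hb hOre
  have hn' : (0 : ℚ) < n := by exact_mod_cast hn
  have hw0 : ∀ i, 0 < i → 0 ≤ w i := fun i hi => by
    have h := S.v_natCast_nonneg i
    rw [← map_natCast (algebraMap K Ω), ← hw i hi] at h
    exact_mod_cast h
  have hl1 : ∀ i, 1 ≤ l i := fun i => by
    rw [hl]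
    split_ifs <;> exact le_max_right _ _
  have hl2 : ∀ i, 1 ≤ i → l i ≤ 2 + a₀ := fun i hi => by
    have := hw0 i hi
    rw [hl]
    split_ifs <;> refine max_le ?_ ?_ <;> omega
  have ha₀ : (a₀ : ℤ) ≤ J₀ := by
    rw [hJ]
    push_cast
    nlinarith
  set d : ℤ := (n : ℤ) + (J₀ : ℤ) - 1 with hd
  set m : ℤ := 2 * d + 3 with hm
  set c : ℤ := n * m - d with hc
  have hn1 : (1 : ℤ) ≤ n := by exact_mod_cast hn
  have hd0 : 0 ≤ d := by omega
  have hcd : d + 3 ≤ c := by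
    have : m ≤ n * m := le_mul_of_one_le_left (by omega) hn1
    omega
  have hδ : ((d / n : ℚ)) < c / n :=
    (div_lt_div_iff_of_pos_right hn').2 (by exact_mod_cast (by omega : d < c))
  have hδγ : (c / n : ℚ) + d / n = m := by
    rw [← add_div, hc]
    push_cast
    field_simp
    ring
  have hδd : (d / n : ℚ) = (n + (a₀ * n + b₀) - 1) / n := by
    rw [hd, hJ]
    push_cast
    rfl
  have hset : Nat.card {L : IntermediateField K Ω // ∃ f : K[X],
        S.IsEisensteinOfDegree f n ∧ ∃ α : Ω, aeval α f = 0 ∧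
          L = IntermediateField.adjoin K {α} ∧
          ((n : ℚ) : WithTop ℚ) * S.v (aeval α (derivative f)) = ((d : ℚ) : WithTop ℚ)} =
      Nat.card (S.ramifiedFields n (d / n)) := by
    refine Nat.card_congr (Equiv.subtypeEquivRight fun L => ?_)
    simp only [PadicSetup.coe_mul_eq_coe_iff hn']
    rfl
  have hfields := S.ncard_mk_eisensteinRoots_fields O hO P hP hq hq2 hn (by omega : 2 ≤ c) hδ
  have hpolys := S.ncard_mk_eisensteinRoots_coeff hn hδ hδγ (C := S.coeffClass b₀ l)
    (fun i x hx => IntermediateField.mem_bot.1 hx.1)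
    (fun f hf hfn h => by
      obtain ⟨hE, h⟩ := (S.forall_mem_coeffClass_iff hn hb hl1 hf hfn).1 h
      refine ⟨hE, fun α hα => ?_⟩
      rw [hδd]
      exact (S.v_derivative_eq_iff hw hn hb h1 h2 h3 hl hE hα).2 h)
    (fun f hE α hα h => by
      rw [hδd] at h
      exact (S.forall_mem_coeffClass_iff hn hb hl1 hE.1 hE.2.1).2
        ⟨hE, (S.v_derivative_eq_iff hw hn hb h1 h2 h3 hl hE hα).1 h⟩)
  rw [S.prod_ncard_mk_coeffClass O hO P hP hq (by omega) hn hb (by omega)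
    (fun i hi _ => (hl2 i hi).trans_lt (by omega)), hfields] at hpolys
  have hq0 : (q : ℚ) ≠ 0 := by exact_mod_cast (by omega : q ≠ 0)
  have hq1 : (q : ℚ) - 1 ≠ 0 := sub_ne_zero.2 (by exact_mod_cast (by omega : q ≠ 1))
  rw [hset]
  set s := ∑ i ∈ Finset.Icc 1 (n - 1), l i
  have hsub : (q : ℚ) ^ (c - 1) - (q : ℚ) ^ (c - 2) = (q - 1) * (q : ℚ) ^ (c - 2) := by
    rw [show c - 1 = c - 2 + 1 by ring, zpow_add_one₀ hq0]
    ring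
  rw [hsub, show (n * m - 2 - s : ℤ) = (d - s) + (c - 2) by rw [hc]; ring, zpow_add₀ hq0] at hpolys
  refine mul_right_cancel₀ (mul_ne_zero hq1 (zpow_ne_zero (c - 2) hq0)) (hpolys.trans ?_)
  split_ifs
  · ring
  · rw [zpow_sub_one₀ hq0]
    field_simp
end
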